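/- arXiv:2005.02813 — 10 statements merged into one kernel-verified Lean document; each statement's English description precedes it below -/
import Mathlib

section
/- Let E ⊆ ℝ² be a 1-separated set. Then for Lebesgue-almost every pair (u,v) ∈ (0,∞) × ℝ (with respect to two-dimensional Lebesgue measure on the parameter plane), the mass dimension of the slice of E by the tube t_{u,v} satisfies D̄(E ∩ t_{u,v}) ≤ max(0, D̄(E) − 1). -/
open Filter MeasureTheory Set

/-- A set `E ⊆ ℝ²` is 1-separated if any two distinct points of `E` are at
Euclidean distance at least 1. -/
def OneSeparated (E : Set (ℝ × ℝ)) : Prop :=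
  ∀ p ∈ E, ∀ q ∈ E, p ≠ q → 1 ≤ Real.sqrt ((p.1 - q.1) ^ 2 + (p.2 - q.2) ^ 2)

/-- The mass dimension of a set `E ⊆ ℝ²`:
`limsup_{l → ∞} log |E ∩ [-l,l]²| / log (2l)`. -/
noncomputable def massDimR (E : Set (ℝ × ℝ)) : ℝ :=
  Filter.limsup (fun l : ℝ =>
    Real.log ((E ∩ (Set.Icc (-l) l ×ˢ Set.Icc (-l) l)).ncard) / Real.log (2 * l))
    Filter.atTop

/-- The tube `t_{u,v}` of width 1, perpendicular slope `u`, displacement `v`. -/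
def tube (u v : ℝ) : Set (ℝ × ℝ) :=
  {q : ℝ × ℝ | -q.1 / u + v * Real.sqrt (1 + 1 / u ^ 2) < q.2 ∧
    q.2 ≤ -q.1 / u + (v + 1) * Real.sqrt (1 + 1 / u ^ 2)}

lemma cell_inj (E : Set (ℝ × ℝ)) (hE : OneSeparated E) :
    Set.InjOn (fun p : ℝ × ℝ => ((⌊2 * p.1⌋, ⌊2 * p.2⌋) : ℤ × ℤ)) E := by
  intro p hp q hq h
  by_contra hne
  have h1 := hE p hp q hq hne
  simp only [Prod.mk.injEq] at h
  have hx := Int.abs_sub_lt_one_of_floor_eq_floor h.1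
  have hy := Int.abs_sub_lt_one_of_floor_eq_floor h.2
  rw [Real.one_le_sqrt] at h1
  rw [abs_lt] at hx hy
  nlinarith

lemma box_eq (l : ℝ) : (Set.Icc (-l) l ×ˢ Set.Icc (-l) l) = {p : ℝ × ℝ | ‖p‖ ≤ l} := by
  ext p
  simp only [Set.mem_prod, Set.mem_Icc, Set.mem_ofPred_eq, Prod.norm_def, sup_le_iff,
    Real.norm_eq_abs, abs_le]

lemma E_countable (E : Set (ℝ × ℝ)) (hE : OneSeparated E) : E.Countable :=
  Set.countable_of_injective_of_countable_image (cell_inj E hE) (Set.to_countable _)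

lemma cell_maps (E : Set (ℝ × ℝ)) (l : ℝ) :
    Set.MapsTo (fun p : ℝ × ℝ => ((⌊2 * p.1⌋, ⌊2 * p.2⌋) : ℤ × ℤ)) (E ∩ {p | ‖p‖ ≤ l})
      (↑(Finset.Icc (-⌈2 * l⌉) ⌈2 * l⌉ ×ˢ Finset.Icc (-⌈2 * l⌉) ⌈2 * l⌉) : Set (ℤ × ℤ)) := by
  rintro p ⟨-, hp⟩
  simp only [Set.mem_ofPred_eq, Prod.norm_def, sup_le_iff, Real.norm_eq_abs, abs_le] at hp
  obtain ⟨⟨h1, h2⟩, h3, h4⟩ := hp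
  have hc := Int.le_ceil (2 * l)
  have key : ∀ x : ℝ, -l ≤ x → x ≤ l → -⌈2 * l⌉ ≤ ⌊2 * x⌋ ∧ ⌊2 * x⌋ ≤ ⌈2 * l⌉ := by
    intro x ha hb
    constructor
    · rw [Int.le_floor]; push_cast; linarith
    · have := Int.floor_le (2 * x)
      have h : (⌊2 * x⌋ : ℝ) ≤ (⌈2 * l⌉ : ℝ) := by linarith
      exact_mod_cast h
  simp only [Finset.coe_product, Set.mem_prod, Finset.coe_Icc, Set.mem_Icc]
  exact ⟨key _ h1 h2, key _ h3 h4⟩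

lemma box_finite (E : Set (ℝ × ℝ)) (hE : OneSeparated E) (l : ℝ) :
    (E ∩ {p | ‖p‖ ≤ l}).Finite :=
  Set.Finite.of_injOn (cell_maps E l) ((cell_inj E hE).mono Set.inter_subset_left)
    (Finset.finite_toSet _)

lemma box_card (E : Set (ℝ × ℝ)) (hE : OneSeparated E) (l : ℝ) (hl : 2 ≤ l) :
    ((E ∩ {p | ‖p‖ ≤ l}).ncard : ℝ) ≤ (2 * l) ^ 4 := by
  have h := Set.ncard_le_ncard_of_injOn _ (cell_maps E l)
    ((cell_inj E hE).mono Set.inter_subset_left) (Finset.finite_toSet _)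
  rw [Set.ncard_coe_finset, Finset.card_product, Int.card_Icc] at h
  have hc := Int.ceil_lt_add_one (2 * l)
  have hc0 : 0 ≤ ⌈2 * l⌉ := Int.ceil_nonneg (by linarith)
  have h2 : ((⌈2 * l⌉ + 1 - -⌈2 * l⌉).toNat : ℝ) ≤ (2 * l) ^ 2 := by
    have h3 : (((⌈2 * l⌉ + 1 - -⌈2 * l⌉).toNat : ℤ) : ℝ) = 2 * (⌈2 * l⌉ : ℝ) + 1 := by
      rw [Int.toNat_of_nonneg (by omega)]; push_cast; ring
    rw [Int.cast_natCast] at h3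
    rw [h3]; nlinarith
  have h4 : ((E ∩ {p | ‖p‖ ≤ l}).ncard : ℝ) ≤
      ((⌈2 * l⌉ + 1 - -⌈2 * l⌉).toNat : ℝ) * ((⌈2 * l⌉ + 1 - -⌈2 * l⌉).toNat : ℝ) := by
    exact_mod_cast h
  have h5 : (0 : ℝ) ≤ ((⌈2 * l⌉ + 1 - -⌈2 * l⌉).toNat : ℝ) := Nat.cast_nonneg _
  calc _ ≤ _ := h4
    _ ≤ (2 * l) ^ 2 * (2 * l) ^ 2 := by gcongr
    _ = _ := by ring

lemma count_of_dim (E : Set (ℝ × ℝ)) (hE : OneSeparated E) (a : ℝ) (ha : massDimR E < a) :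
    ∀ᶠ l : ℝ in atTop, ((E ∩ {p | ‖p‖ ≤ l}).ncard : ℝ) ≤ (2 * l) ^ a := by
  unfold massDimR at ha
  simp only [box_eq] at ha
  have hb : IsBoundedUnder (· ≤ ·) atTop (fun l : ℝ =>
      Real.log ((E ∩ {p | ‖p‖ ≤ l}).ncard) / Real.log (2 * l)) := by
    refine ⟨4, ?_⟩
    rw [eventually_map]
    filter_upwards [eventually_ge_atTop 2] with l hl
    have hlog : 0 < Real.log (2 * l) := Real.log_pos (by linarith)
    rw [div_le_iff₀ hlog]
    rcases Nat.eq_zero_or_pos (E ∩ {p | ‖p‖ ≤ l}).ncard with h0 | h0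
    · rw [h0]; simp; linarith
    · calc _ ≤ Real.log ((2 * l) ^ 4) :=
            Real.log_le_log (by exact_mod_cast h0) (box_card E hE l hl)
        _ = _ := by rw [Real.log_pow]; norm_num
  filter_upwards [eventually_lt_of_limsup_lt ha hb, eventually_ge_atTop 2] with l h1 hl
  have hlog : 0 < Real.log (2 * l) := Real.log_pos (by linarith)
  rw [div_lt_iff₀ hlog] at h1
  rcases Nat.eq_zero_or_pos (E ∩ {p | ‖p‖ ≤ l}).ncard with h0 | h0
  · rw [h0]; simp; positivity
  · rw [← Real.log_le_log_iff (by exact_mod_cast h0) (by positivity),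
      Real.log_rpow (by positivity)]
    exact h1.le

lemma sum_finite (E : Set (ℝ × ℝ)) (hE : OneSeparated E) (a b : ℝ) (hab : a < b) (hb : 0 ≤ b)
    (ha : massDimR E < a) :
    ∑' p : E, ENNReal.ofReal ((1 + ‖(p : ℝ × ℝ)‖) ^ (-b)) < ⊤ := by
  classical
  set N : ℕ → ℕ := fun k => (E ∩ {p | ‖p‖ ≤ (2 : ℝ) ^ k}).ncard with hN
  have hsum : Summable (fun k : ℕ => (N k : ℝ) * ((2 : ℝ) ^ k) ^ (-b)) := by
    have hg : Summable (fun k : ℕ => (2 : ℝ) ^ a * ((2 : ℝ) ^ (a - b)) ^ k) := by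
      apply Summable.mul_left
      apply summable_geometric_of_lt_one (by positivity)
      exact Real.rpow_lt_one_of_one_lt_of_neg (by norm_num) (by linarith)
    refine Summable.of_norm_bounded_eventually_nat hg ?_
    have ht : Tendsto (fun k : ℕ => (2 : ℝ) ^ k) atTop atTop :=
      tendsto_pow_atTop_atTop_of_one_lt (by norm_num)
    filter_upwards [ht.eventually (count_of_dim E hE a ha)] with k hk
    rw [Real.norm_of_nonneg (by positivity)]
    calc (N k : ℝ) * ((2 : ℝ) ^ k) ^ (-b) ≤ (2 * 2 ^ k) ^ a * ((2 : ℝ) ^ k) ^ (-b) := by gcongr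
      _ = _ := by
        rw [Real.mul_rpow (by norm_num) (by positivity), mul_assoc,
          ← Real.rpow_add (by positivity), ← Real.rpow_natCast, ← Real.rpow_natCast,
          ← Real.rpow_mul (by norm_num), ← Real.rpow_mul (by norm_num)]
        congr 2; ring
  set w : ℝ × ℝ → ℕ → ENNReal := fun p k =>
    if ‖p‖ ≤ (2 : ℝ) ^ k then ENNReal.ofReal (((2 : ℝ) ^ k) ^ (-b)) else 0 with hw
  have hpt : ∀ p : ℝ × ℝ, ENNReal.ofReal ((1 + ‖p‖) ^ (-b)) ≤
      ENNReal.ofReal ((2 : ℝ) ^ b) * ∑' k, w p k := by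
    intro p
    have hp := norm_nonneg p
    obtain ⟨n, h1, h2⟩ := exists_nat_pow_near (x := 1 + ‖p‖) (y := (2 : ℝ)) (by linarith)
      (by norm_num)
    calc ENNReal.ofReal ((1 + ‖p‖) ^ (-b))
        ≤ ENNReal.ofReal ((2 : ℝ) ^ b * ((2 : ℝ) ^ (n + 1)) ^ (-b)) := by
          apply ENNReal.ofReal_le_ofReal
          calc (1 + ‖p‖) ^ (-b) ≤ ((2 : ℝ) ^ n) ^ (-b) :=
                Real.rpow_le_rpow_of_nonpos (by positivity) h1 (by linarith)
            _ = _ := by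
              rw [pow_succ', Real.mul_rpow (by norm_num) (by positivity), ← mul_assoc,
                ← Real.rpow_add (by norm_num)]
              simp
      _ = ENNReal.ofReal ((2 : ℝ) ^ b) * w p (n + 1) := by
          rw [ENNReal.ofReal_mul (by positivity), hw]
          simp only
          rw [if_pos (by linarith)]
      _ ≤ _ := by gcongr; exact ENNReal.le_tsum _
  have hcount : ∀ k, ∑' p : E, w p k = ENNReal.ofReal ((N k : ℝ) * ((2 : ℝ) ^ k) ^ (-b)) := by
    intro k
    have hfin := box_finite E hE ((2 : ℝ) ^ k)
    rw [tsum_subtype E (fun p => w p k)]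
    rw [tsum_eq_sum (s := hfin.toFinset)]
    · rw [Finset.sum_congr rfl (g := fun _ => ENNReal.ofReal (((2 : ℝ) ^ k) ^ (-b)))]
      · rw [Finset.sum_const, nsmul_eq_mul, ENNReal.ofReal_mul (by positivity),
          ENNReal.ofReal_natCast, hN]
        simp only
        rw [Set.ncard_eq_toFinset_card _ hfin]
      · intro p hp
        rw [Set.Finite.mem_toFinset] at hp
        rw [Set.indicator_of_mem hp.1]
        exact if_pos hp.2
    · intro p hp
      rw [Set.Finite.mem_toFinset] at hp
      by_cases hpE : p ∈ E
      · rw [Set.indicator_of_mem hpE]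
        exact if_neg (fun h => hp ⟨hpE, h⟩)
      · exact Set.indicator_of_notMem hpE _
  calc _ ≤ ∑' p : E, ENNReal.ofReal ((2 : ℝ) ^ b) * ∑' k, w p k :=
        ENNReal.tsum_le_tsum (fun p => hpt p)
    _ = ENNReal.ofReal ((2 : ℝ) ^ b) * ∑' k, ∑' p : E, w p k := by
        rw [ENNReal.tsum_mul_left, ENNReal.tsum_comm]
    _ < ⊤ := by
        simp only [hcount]
        rw [← ENNReal.ofReal_tsum_of_nonneg (fun k => by positivity) hsum]
        exact ENNReal.mul_lt_top ENNReal.ofReal_lt_top ENNReal.ofReal_lt_top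

lemma tube_iff (p : ℝ × ℝ) (u v : ℝ) (hu : 0 < u) :
    p ∈ tube u v ↔ v * Real.sqrt (1 + u ^ 2) < p.1 + u * p.2 ∧
      p.1 + u * p.2 ≤ (v + 1) * Real.sqrt (1 + u ^ 2) := by
  have hs : Real.sqrt (1 + 1 / u ^ 2) = Real.sqrt (1 + u ^ 2) / u := by
    rw [show 1 + 1 / u ^ 2 = (1 + u ^ 2) / u ^ 2 by field_simp; ring,
      Real.sqrt_div (by positivity), Real.sqrt_sq hu.le]
  unfold tube
  rw [Set.mem_ofPred_eq, hs]
  have e1 : -p.1 / u + v * (Real.sqrt (1 + u ^ 2) / u) = (v * Real.sqrt (1 + u ^ 2) - p.1) / u := by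
    ring
  have e2 : -p.1 / u + (v + 1) * (Real.sqrt (1 + u ^ 2) / u)
      = ((v + 1) * Real.sqrt (1 + u ^ 2) - p.1) / u := by
    ring
  rw [e1, e2, div_lt_iff₀ hu, le_div_iff₀ hu]
  constructor <;> rintro ⟨h1, h2⟩ <;> constructor <;> linarith

lemma tube_meas (p : ℝ × ℝ) : MeasurableSet {uv : ℝ × ℝ | p ∈ tube uv.1 uv.2} := by
  have h1 : MeasurableSet {uv : ℝ × ℝ |
      -p.1 / uv.1 + uv.2 * Real.sqrt (1 + 1 / uv.1 ^ 2) < p.2} :=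
    measurableSet_lt (f := fun uv : ℝ × ℝ => -p.1 / uv.1 + uv.2 * Real.sqrt (1 + 1 / uv.1 ^ 2))
      (g := fun _ => p.2) (by fun_prop) (by fun_prop)
  have h2 : MeasurableSet {uv : ℝ × ℝ |
      p.2 ≤ -p.1 / uv.1 + (uv.2 + 1) * Real.sqrt (1 + 1 / uv.1 ^ 2)} :=
    measurableSet_le (f := fun _ => p.2)
      (g := fun uv : ℝ × ℝ => -p.1 / uv.1 + (uv.2 + 1) * Real.sqrt (1 + 1 / uv.1 ^ 2))
      (by fun_prop) (by fun_prop)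
  exact h1.inter h2

lemma strip_vol (x y M K : ℝ) (hM : 1 ≤ M) (hK : 0 ≤ K) :
    volume ({u : ℝ | u ∈ Ioo 0 M ∧ |x + u * y| ≤ K}) ≤
      ENNReal.ofReal ((M + 4 * K * M) / (1 + max |x| |y|)) := by
  set r := max |x| |y| with hr
  have hr0 : 0 ≤ r := le_max_of_le_left (abs_nonneg x)
  have hbase : volume ({u : ℝ | u ∈ Ioo 0 M ∧ |x + u * y| ≤ K}) ≤ ENNReal.ofReal M := by
    calc _ ≤ volume (Ioo 0 M) := measure_mono (fun u hu => hu.1)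
      _ = _ := by rw [Real.volume_Ioo]; simp
  -- sufficient: a real bound m
  have suff : ∀ m : ℝ, m * r ≤ 4 * K * M → m ≤ M →
      m ≤ (M + 4 * K * M) / (1 + r) := by
    intro m h1 h2
    rw [le_div_iff₀ (by linarith)]; nlinarith
  by_cases hc : |x| ≤ 2 * M * |y|
  · have hry : r ≤ 2 * M * |y| := max_le hc (by nlinarith [abs_nonneg y])
    by_cases hy : y = 0
    · have : r = 0 := by subst hy; simp at hry; linarith
      exact hbase.trans (ENNReal.ofReal_le_ofReal
        (suff M (by rw [this]; simp; positivity) le_rfl))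
    · have hy' : 0 < |y| := abs_pos.mpr hy
      have hint : volume ({u : ℝ | u ∈ Ioo 0 M ∧ |x + u * y| ≤ K}) ≤
          ENNReal.ofReal (2 * (K / |y|)) := by
        calc _ ≤ volume (Metric.closedBall (-x / y) (K / |y|)) := by
              apply measure_mono
              rintro u ⟨-, h⟩
              rw [Metric.mem_closedBall, Real.dist_eq, le_div_iff₀ hy', ← abs_mul]
              have e : (u - -x / y) * y = x + u * y := by
                rw [sub_mul, div_mul_cancel₀ _ hy]; ring
              rw [e]; exact h
          _ = _ := Real.volume_closedBall _ _
      rcases le_total (2 * (K / |y|)) M with h | h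
      · refine hint.trans (ENNReal.ofReal_le_ofReal (suff _ ?_ h))
        calc 2 * (K / |y|) * r ≤ 2 * (K / |y|) * (2 * M * |y|) := by gcongr
          _ = 4 * K * M := by field_simp; ring
      · refine hbase.trans (ENNReal.ofReal_le_ofReal (suff _ ?_ le_rfl))
        calc M * r ≤ 2 * (K / |y|) * (2 * M * |y|) := by gcongr
          _ = 4 * K * M := by field_simp; ring
  · push Not at hc
    have hrx : r = |x| := max_eq_left (by nlinarith [abs_nonneg y])
    by_cases hx : |x| ≤ 2 * K
    · refine hbase.trans (ENNReal.ofReal_le_ofReal (suff _ ?_ le_rfl))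
      rw [hrx]; nlinarith
    · have : {u : ℝ | u ∈ Ioo 0 M ∧ |x + u * y| ≤ K} = ∅ := by
        ext u
        simp only [Set.mem_ofPred_eq, Set.mem_empty_iff_false, iff_false]
        rintro ⟨⟨h1, h2⟩, h3⟩
        have h4 : |u * y| ≤ M * |y| := by
          rw [abs_mul, abs_of_pos h1]; gcongr
        have h5 : |x| ≤ |x + u * y| + |u * y| := by
          have := abs_sub (x + u * y) (u * y)
          simpa using this
        linarith
      rw [this]; simp

lemma tube_vol (p : ℝ × ℝ) (M : ℝ) (hM : 1 ≤ M) :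
    volume ({uv : ℝ × ℝ | p ∈ tube uv.1 uv.2} ∩ (Ioo 0 M ×ˢ Icc (-M) M)) ≤
      ENNReal.ofReal ((M + 4 * ((M + 1) * (1 + M)) * M) / (1 + ‖p‖)) := by
  set K := (M + 1) * (1 + M) with hK
  have hK0 : 0 ≤ K := by positivity
  have hms : MeasurableSet ({u : ℝ | u ∈ Ioo 0 M ∧ |p.1 + u * p.2| ≤ K}) :=
    measurableSet_Ioo.inter (measurableSet_le
      (f := fun u : ℝ => |p.1 + u * p.2|) (g := fun _ => K)
      (Measurable.abs (by fun_prop)) (by fun_prop))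
  rw [Measure.volume_eq_prod, Measure.prod_apply
    ((tube_meas p).inter (measurableSet_Ioo.prod measurableSet_Icc))]
  calc _ ≤ ∫⁻ u, ({u : ℝ | u ∈ Ioo 0 M ∧ |p.1 + u * p.2| ≤ K}).indicator 1 u := by
        apply lintegral_mono
        intro u
        simp only
        by_cases hu : u ∈ {u : ℝ | u ∈ Ioo 0 M ∧ |p.1 + u * p.2| ≤ K}
        · rw [Set.indicator_of_mem hu]
          have hs : 0 < Real.sqrt (1 + u ^ 2) := by positivity
          set c := (p.1 + u * p.2) / Real.sqrt (1 + u ^ 2) with hc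
          calc _ ≤ volume (Icc (c - 1) c) := by
                apply measure_mono
                rintro v ⟨h1, -⟩
                simp only [Set.mem_ofPred_eq] at h1
                rw [tube_iff _ _ _ hu.1.1] at h1
                constructor
                · have : c ≤ v + 1 := by rw [hc, div_le_iff₀ hs]; exact h1.2
                  linarith
                · rw [hc, le_div_iff₀ hs]; exact h1.1.le
            _ = 1 := by rw [Real.volume_Icc]; simp
        · rw [Set.indicator_of_notMem hu]
          have : (Prod.mk u ⁻¹' ({uv : ℝ × ℝ | p ∈ tube uv.1 uv.2} ∩
              (Ioo 0 M ×ˢ Icc (-M) M))) = ∅ := by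
            ext v
            simp only [Set.mem_preimage, Set.mem_inter_iff, Set.mem_ofPred_eq, Set.mem_prod,
              Set.mem_empty_iff_false, iff_false]
            rintro ⟨h1, h2, h3, h4⟩
            apply hu
            refine ⟨h2, ?_⟩
            rw [tube_iff _ _ _ h2.1] at h1
            obtain ⟨ha, hb⟩ := h1
            have hs0 : 0 ≤ Real.sqrt (1 + u ^ 2) := Real.sqrt_nonneg _
            have hs : Real.sqrt (1 + u ^ 2) ≤ 1 + M := by
              rw [Real.sqrt_le_left (by linarith)]
              nlinarith [h2.1, h2.2]
            rw [abs_le]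
            constructor
            · nlinarith
            · nlinarith
          rw [this]; simp
    _ = volume ({u : ℝ | u ∈ Ioo 0 M ∧ |p.1 + u * p.2| ≤ K}) := lintegral_indicator_one hms
    _ ≤ _ := strip_vol p.1 p.2 M K hM hK0

lemma ae_finite (E : Set (ℝ × ℝ)) (hE : OneSeparated E) (s a : ℝ) (hs : 0 ≤ s)
    (ha : massDimR E < a) (has : a < 1 + s) (M : ℝ) (hM : 1 ≤ M) :
    ∀ᵐ uv : ℝ × ℝ, uv ∈ Ioo 0 M ×ˢ Icc (-M) M →
      ∑' p : E, ({uv : ℝ × ℝ | (p : ℝ × ℝ) ∈ tube uv.1 uv.2}).indicator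
        (fun _ => ENNReal.ofReal ((1 + ‖(p : ℝ × ℝ)‖) ^ (-s))) uv < ⊤ := by
  have : Countable E := (E_countable E hE).to_subtype
  rw [← ae_restrict_iff' (measurableSet_Ioo.prod measurableSet_Icc)]
  have hm : ∀ p : E, Measurable (({uv : ℝ × ℝ | (p : ℝ × ℝ) ∈ tube uv.1 uv.2}).indicator
        (fun _ => ENNReal.ofReal ((1 + ‖(p : ℝ × ℝ)‖) ^ (-s)))) :=
    fun p => measurable_const.indicator (tube_meas p)
  apply ae_lt_top (Measurable.ennreal_tsum hm)
  rw [lintegral_tsum (fun p => (hm p).aemeasurable)]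
  set C := M + 4 * ((M + 1) * (1 + M)) * M with hC
  have hC0 : 0 ≤ C := by positivity
  apply ne_of_lt
  calc _ ≤ ∑' p : E, ENNReal.ofReal C * ENNReal.ofReal ((1 + ‖(p : ℝ × ℝ)‖) ^ (-(1 + s))) := by
        apply ENNReal.tsum_le_tsum
        intro p
        have hp : 0 < 1 + ‖(p : ℝ × ℝ)‖ := by positivity
        rw [lintegral_indicator_const (tube_meas p), Measure.restrict_apply (tube_meas p)]
        calc _ ≤ ENNReal.ofReal ((1 + ‖(p : ℝ × ℝ)‖) ^ (-s)) *
              ENNReal.ofReal (C / (1 + ‖(p : ℝ × ℝ)‖)) := by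
              gcongr; exact tube_vol p M hM
          _ = _ := by
              rw [← ENNReal.ofReal_mul (by positivity), ← ENNReal.ofReal_mul hC0]
              congr 1
              rw [neg_add, Real.rpow_add hp, Real.rpow_neg_one]
              ring
    _ < ⊤ := by
        rw [ENNReal.tsum_mul_left]
        exact ENNReal.mul_lt_top ENNReal.ofReal_lt_top
          (sum_finite E hE a (1 + s) has (by linarith) ha)

lemma dim_le (E : Set (ℝ × ℝ)) (hE : OneSeparated E) (s : ℝ) (hs : 0 ≤ s) (u v : ℝ)
    (h : ∑' p : E, ({uv : ℝ × ℝ | (p : ℝ × ℝ) ∈ tube uv.1 uv.2}).indicator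
        (fun _ => ENNReal.ofReal ((1 + ‖(p : ℝ × ℝ)‖) ^ (-s))) (u, v) < ⊤) :
    massDimR (E ∩ tube u v) ≤ s := by
  classical
  set S := ∑' p : E, ({uv : ℝ × ℝ | (p : ℝ × ℝ) ∈ tube uv.1 uv.2}).indicator
        (fun _ => ENNReal.ofReal ((1 + ‖(p : ℝ × ℝ)‖) ^ (-s))) (u, v) with hS
  set F := S.toReal + 1 with hF
  have hF1 : 1 ≤ F := by have := ENNReal.toReal_nonneg (a := S); linarith
  have hcount : ∀ l : ℝ, 1 ≤ l →
      (((E ∩ tube u v) ∩ {p | ‖p‖ ≤ l}).ncard : ℝ) ≤ (2 * l) ^ s * F := by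
    intro l hl
    have hfin : ((E ∩ tube u v) ∩ {p | ‖p‖ ≤ l}).Finite :=
      (box_finite E hE l).subset (fun p hp => ⟨hp.1.1, hp.2⟩)
    have h1 : (((E ∩ tube u v) ∩ {p | ‖p‖ ≤ l}).ncard : ENNReal) *
        ENNReal.ofReal ((2 * l) ^ (-s)) ≤ S := by
      rw [hS, tsum_subtype E (fun p => ({uv : ℝ × ℝ | p ∈ tube uv.1 uv.2}).indicator
        (fun _ => ENNReal.ofReal ((1 + ‖p‖) ^ (-s))) (u, v)),
        Set.ncard_eq_toFinset_card _ hfin, ← nsmul_eq_mul, ← Finset.sum_const]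
      refine le_trans ?_ (ENNReal.sum_le_tsum hfin.toFinset)
      apply Finset.sum_le_sum
      intro p hp
      rw [Set.Finite.mem_toFinset] at hp
      have hmem : (u, v) ∈ {uv : ℝ × ℝ | p ∈ tube uv.1 uv.2} := hp.1.2
      rw [Set.indicator_of_mem hp.1.1, Set.indicator_of_mem hmem]
      apply ENNReal.ofReal_le_ofReal
      have : ‖p‖ ≤ l := hp.2
      exact Real.rpow_le_rpow_of_nonpos (by positivity) (by linarith) (by linarith)
    have h2 := ENNReal.toReal_mono h.ne h1
    rw [ENNReal.toReal_mul, ENNReal.toReal_natCast, ENNReal.toReal_ofReal (by positivity),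
      Real.rpow_neg (by positivity), ← div_eq_mul_inv, div_le_iff₀ (by positivity)] at h2
    have h3 : 0 ≤ (2 * l) ^ s := by positivity
    nlinarith
  unfold massDimR
  simp only [box_eq]
  apply le_of_forall_pos_le_add
  intro δ hδ
  apply limsup_le_of_le
  · apply IsBoundedUnder.isCoboundedUnder_le
    refine ⟨0, ?_⟩
    rw [eventually_map]
    filter_upwards [eventually_ge_atTop 1] with l hl
    exact div_nonneg (Real.log_natCast_nonneg _) (Real.log_nonneg (by linarith))
  · have ht : Tendsto (fun l : ℝ => Real.log (2 * l)) atTop atTop :=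
      Real.tendsto_log_atTop.comp (tendsto_id.const_mul_atTop (by norm_num))
    filter_upwards [eventually_ge_atTop 1, ht.eventually_ge_atTop (Real.log F / δ)] with l hl h1
    have hlog : 0 < Real.log (2 * l) := Real.log_pos (by linarith)
    have hlF : 0 ≤ Real.log F := Real.log_nonneg hF1
    rw [div_le_iff₀ hδ] at h1
    rw [div_le_iff₀ hlog]
    rcases Nat.eq_zero_or_pos ((E ∩ tube u v) ∩ {p | ‖p‖ ≤ l}).ncard with h0 | h0
    · rw [h0]; simp; positivity
    · have h2 := Real.log_le_log (by exact_mod_cast h0) (hcount l hl)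
      rw [Real.log_mul (by positivity) (by positivity), Real.log_rpow (by positivity)] at h2
      linarith

/-- Slicing theorem: for a 1-separated `E ⊆ ℝ²`, for Lebesgue-a.e. pair
`(u,v) ∈ (0,∞) × ℝ`, `D̄(E ∩ t_{u,v}) ≤ max(0, D̄(E) - 1)`. -/
theorem slicing (E : Set (ℝ × ℝ)) (hE : OneSeparated E) :
    ∀ᵐ uv : ℝ × ℝ ∂(MeasureTheory.volume.restrict
      (Set.Ioi (0 : ℝ) ×ˢ (Set.univ : Set ℝ))),
      massDimR (E ∩ tube uv.1 uv.2) ≤ max 0 (massDimR E - 1) := by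
  rw [ae_restrict_iff' (measurableSet_Ioi.prod MeasurableSet.univ)]
  set D := massDimR E with hD
  have key : ∀ n m : ℕ, ∀ᵐ uv : ℝ × ℝ, uv ∈ Ioo 0 ((m : ℝ) + 1) ×ˢ Icc (-((m : ℝ) + 1)) ((m : ℝ) + 1) →
      massDimR (E ∩ tube uv.1 uv.2) ≤ max 0 (D - 1) + 1 / ((n : ℝ) + 1) := by
    intro n m
    have he : (0 : ℝ) < 1 / ((n : ℝ) + 1) := by positivity
    have h0 := le_max_left 0 (D - 1)
    have h1 := le_max_right 0 (D - 1)
    have hs : 0 ≤ max 0 (D - 1) + 1 / ((n : ℝ) + 1) := by linarith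
    filter_upwards [ae_finite E hE (max 0 (D - 1) + 1 / ((n : ℝ) + 1))
      (D + 1 / ((n : ℝ) + 1) / 2) hs (by linarith) (by linarith) ((m : ℝ) + 1)
      (by linarith [Nat.cast_nonneg (α := ℝ) m])] with uv h hmem
    exact dim_le E hE _ hs uv.1 uv.2 (h hmem)
  have key2 := ae_all_iff.mpr (fun n => ae_all_iff.mpr (key n))
  filter_upwards [key2] with uv h hmem
  have hu : 0 < uv.1 := hmem.1
  apply le_of_forall_pos_le_add
  intro δ hδ
  obtain ⟨n, hn⟩ := exists_nat_one_div_lt hδ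
  obtain ⟨m, hm⟩ := exists_nat_gt (max uv.1 |uv.2|)
  have hm1 : uv.1 < m := lt_of_le_of_lt (le_max_left _ _) hm
  have hm2 : |uv.2| < m := lt_of_le_of_lt (le_max_right _ _) hm
  rw [abs_lt] at hm2
  have := h n m ⟨⟨hu, by linarith⟩, by linarith, by linarith⟩
  linarith
end

section
/- Let A, B ⊆ ℕ. Then for Lebesgue-almost every (u,v) ∈ ℝ², the mass dimension of A ∩ ⌊uB + v⌋ satisfies D̄(A ∩ ⌊uB + v⌋) ≤ max(0, D̄(A) + D̄(B) − 1). -/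
open Filter MeasureTheory Set

/-- The mass dimension of `A ⊆ ℕ`: `limsup_{N → ∞} log |A ∩ {1,…,N}| / log N`. -/
noncomputable def massDimN (A : Set ℕ) : ℝ :=
  Filter.limsup (fun N : ℕ =>
    Real.log ((A ∩ Set.Icc 1 N).ncard) / Real.log N) Filter.atTop

/-- The set `A ∩ ⌊u·B + v⌋ = {a ∈ A : ∃ b ∈ B, a = ⌊u·b + v⌋}`. -/
def interFloor (A B : Set ℕ) (u v : ℝ) : Set ℕ :=
  {a ∈ A | ∃ b ∈ B, (a : ℤ) = ⌊u * (b : ℝ) + v⌋}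

lemma massDimN_nonneg_terms (A : Set ℕ) (N : ℕ) :
    0 ≤ Real.log ((A ∩ Set.Icc 1 N).ncard) / Real.log N :=
  div_nonneg (Real.log_natCast_nonneg _) (Real.log_natCast_nonneg _)

lemma ncard_inter_le (A : Set ℕ) (N : ℕ) : (A ∩ Set.Icc 1 N).ncard ≤ N := by
  have h := Set.ncard_le_ncard (Set.inter_subset_right : A ∩ Set.Icc 1 N ⊆ Set.Icc 1 N)
    (Set.finite_Icc 1 N)
  have h2 : (Set.Icc 1 N).ncard = N := by
    rw [← Finset.coe_Icc, Set.ncard_coe_finset]; simp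
  omega

lemma massDimN_terms_le_one (A : Set ℕ) (N : ℕ) :
    Real.log ((A ∩ Set.Icc 1 N).ncard) / Real.log N ≤ 1 := by
  apply div_le_one_of_le₀ _ (Real.log_natCast_nonneg _)
  rcases Nat.eq_zero_or_pos (A ∩ Set.Icc 1 N).ncard with h | h
  · rw [h]; simpa using Real.log_natCast_nonneg N
  · apply Real.log_le_log (by exact_mod_cast h)
    exact_mod_cast ncard_inter_le A N

lemma massDimN_bdd (A : Set ℕ) : Filter.IsBoundedUnder (· ≤ ·) Filter.atTop
    (fun N : ℕ => Real.log ((A ∩ Set.Icc 1 N).ncard) / Real.log N) :=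
  Filter.isBoundedUnder_of ⟨1, massDimN_terms_le_one A⟩

lemma massDimN_cobdd (A : Set ℕ) : Filter.IsCoboundedUnder (· ≤ ·) Filter.atTop
    (fun N : ℕ => Real.log ((A ∩ Set.Icc 1 N).ncard) / Real.log N) :=
  (Filter.isBoundedUnder_of ⟨0, massDimN_nonneg_terms A⟩ :
    Filter.IsBoundedUnder (· ≥ ·) _ _).isCoboundedUnder_le

lemma massDimN_nonneg (A : Set ℕ) : 0 ≤ massDimN A := by
  unfold massDimN
  apply Filter.le_limsup_of_frequently_le _ (massDimN_bdd A)
  exact (Filter.Eventually.of_forall (massDimN_nonneg_terms A)).frequently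

lemma massDimN_le_of_count (A : Set ℕ) (C s : ℝ) (hs : 0 ≤ s)
    (h : ∀ N : ℕ, 1 ≤ N → ((A ∩ Set.Icc 1 N).ncard : ℝ) ≤ C * (N : ℝ) ^ s) :
    massDimN A ≤ s := by
  apply le_of_forall_pos_le_add
  intro δ hδ
  unfold massDimN
  apply Filter.limsup_le_of_le (massDimN_cobdd A)
  have ht : Filter.Tendsto (fun N : ℕ => Real.log N) Filter.atTop Filter.atTop :=
    Real.tendsto_log_atTop.comp tendsto_natCast_atTop_atTop
  filter_upwards [ht.eventually_ge_atTop (Real.log C / δ), Filter.eventually_ge_atTop 2]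
    with N hN hN2
  have hlogpos : 0 < Real.log N := Real.log_pos (by exact_mod_cast hN2)
  have hNpos : (0 : ℝ) < N := by positivity
  rw [div_le_iff₀ hlogpos]
  rcases Nat.eq_zero_or_pos (A ∩ Set.Icc 1 N).ncard with h0 | h0
  · rw [h0]; simp; positivity
  · have h1 := h N (by omega)
    have h0' : (0 : ℝ) < (A ∩ Set.Icc 1 N).ncard := by exact_mod_cast h0
    have hp : (0 : ℝ) < (N : ℝ) ^ s := by positivity
    have hC : 0 < C := by
      by_contra hc
      push Not at hc
      nlinarith
    have h2 := Real.log_le_log h0' h1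
    rw [Real.log_mul hC.ne' hp.ne', Real.log_rpow hNpos] at h2
    rw [div_le_iff₀ hδ] at hN
    linarith

lemma massDimN_summable (A : Set ℕ) (p : ℝ) (hp : massDimN A < p) :
    Summable (Set.indicator (A ∩ Set.Ici 1) (fun a : ℕ => (a : ℝ) ^ (-p))) := by
  obtain ⟨q, hq1, hq2⟩ := exists_between hp
  have hq : 0 < q := lt_of_le_of_lt (massDimN_nonneg A) hq1
  have hev := Filter.eventually_lt_of_limsup_lt (u := fun N : ℕ =>
    Real.log ((A ∩ Set.Icc 1 N).ncard) / Real.log N) hq1 (massDimN_bdd A)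
  obtain ⟨N0, hN0⟩ := Filter.eventually_atTop.1 hev
  set r : ℕ → ℕ := fun a => (A ∩ Set.Icc 1 a).ncard with hr
  have hfin : ∀ a : ℕ, (A ∩ Set.Icc 1 a).Finite := fun a =>
    (Set.finite_Icc 1 a).subset Set.inter_subset_right
  have hinj : Set.InjOn r (A ∩ Set.Ici 1) := by
    have key : ∀ a b : ℕ, b ∈ A ∩ Set.Ici 1 → a < b → r a < r b := by
      intro a b hb hab
      apply Set.ncard_lt_ncard _ (hfin b)
      refine (Set.ssubset_iff_of_subset ?_).2 ⟨b, ⟨hb.1, hb.2, le_rfl⟩, ?_⟩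
      · rintro x ⟨h1, h2, h3⟩
        exact ⟨h1, h2, by omega⟩
      · rintro ⟨_, _, h3⟩
        omega
    intro a ha b hb hab
    rcases lt_trichotomy a b with h | h | h
    · have := key a b hb h; omega
    · exact h
    · have := key b a ha h; omega
  rw [← summable_subtype_iff_indicator]
  have hsum : Summable (fun n : ℕ => (n : ℝ) ^ (-(p / q))) :=
    Real.summable_nat_rpow.2 (by
      have : 1 < p / q := (one_lt_div hq).2 hq2
      linarith)
  have hsum2 := hsum.comp_injective (i := fun a : ↥(A ∩ Set.Ici 1) => r a)
    (fun a b hab => Subtype.ext (hinj a.2 b.2 hab))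
  refine Summable.of_norm_bounded_eventually hsum2 ?_
  have hsmall : {a : ↥(A ∩ Set.Ici 1) | (a : ℕ) < N0 + 2}.Finite :=
    Set.Finite.preimage Subtype.val_injective.injOn (Set.finite_Iio (N0 + 2))
  filter_upwards [hsmall.compl_mem_cofinite] with a ha
  simp only [Set.mem_compl_iff, Set.mem_ofPred_eq, not_lt] at ha
  have hapos : (0 : ℝ) < (a : ℕ) := by
    have : 0 < (a : ℕ) := by omega
    exact_mod_cast this
  have hlog : 0 < Real.log (a : ℕ) := Real.log_pos (by
    have : 1 < (a : ℕ) := by omega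
    exact_mod_cast this)
  have hrpos : 0 < r a := by
    apply (Set.ncard_pos (hfin a)).2
    exact ⟨a, a.2.1, a.2.2, le_rfl⟩
  have hrpos' : (0 : ℝ) < r a := by exact_mod_cast hrpos
  have h1 := hN0 a (by omega)
  rw [div_lt_iff₀ hlog] at h1
  have h2 : (r a : ℝ) ≤ ((a : ℕ) : ℝ) ^ q := by
    rw [← Real.log_le_log_iff hrpos' (by positivity), Real.log_rpow hapos]
    exact h1.le
  simp only [Function.comp_apply]
  rw [Real.norm_of_nonneg (by positivity)]
  calc ((a : ℕ) : ℝ) ^ (-p) = (((a : ℕ) : ℝ) ^ q) ^ (-(p / q)) := by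
        rw [← Real.rpow_mul hapos.le]; congr 1; field_simp
    _ ≤ (r a : ℝ) ^ (-(p / q)) := by
        apply Real.rpow_le_rpow_of_nonpos hrpos' h2
        have : 0 < p / q := div_pos (hq.trans hq2) hq
        linarith

/-- Parameters in the box of size `M` for which `a = ⌊u b + v⌋`. -/
def boxSet (M : ℝ) (a b : ℕ) : Set (ℝ × ℝ) :=
  {x | 1 / M ≤ x.1 ∧ x.1 ≤ M ∧ -M ≤ x.2 ∧ x.2 ≤ M ∧ (a : ℤ) = ⌊x.1 * (b : ℝ) + x.2⌋}

lemma boxSet_meas (M : ℝ) (a b : ℕ) : MeasurableSet (boxSet M a b) := by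
  unfold boxSet
  have h : Measurable (fun x : ℝ × ℝ => ⌊x.1 * (b : ℝ) + x.2⌋) := by fun_prop
  refine (measurableSet_le measurable_const measurable_fst).inter
    ((measurableSet_le measurable_fst measurable_const).inter
    ((measurableSet_le measurable_const measurable_snd).inter
    ((measurableSet_le measurable_snd measurable_const).inter
    (measurableSet_eq_fun measurable_const h))))

lemma boxSet_vol (M : ℝ) (hM : 0 < M) (a b : ℕ) (hb : 1 ≤ b) :
    volume (boxSet M a b) ≤ ENNReal.ofReal (2 * M / b) := by
  have hb' : (0 : ℝ) < b := by exact_mod_cast hb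
  rw [Measure.volume_eq_prod, Measure.prod_apply_symm (boxSet_meas M a b)]
  calc ∫⁻ y, volume ((fun x : ℝ => (x, y)) ⁻¹' boxSet M a b)
      ≤ ∫⁻ y, (Set.Icc (-M) M).indicator (fun _ => ENNReal.ofReal (1 / b)) y := by
        apply lintegral_mono
        intro y
        by_cases hy : y ∈ Set.Icc (-M) M
        · rw [Set.indicator_of_mem hy]
          have hsub : (fun x : ℝ => (x, y)) ⁻¹' boxSet M a b ⊆
              Set.Icc ((a - y) / b) ((a + 1 - y) / b) := by
            rintro x ⟨_, _, _, _, h⟩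
            have h' := Int.floor_eq_iff.1 h.symm
            simp only [Int.cast_natCast] at h'
            constructor
            · rw [div_le_iff₀ hb']; linarith
            · rw [le_div_iff₀ hb']; linarith
          refine (measure_mono hsub).trans ?_
          rw [Real.volume_Icc]
          apply le_of_eq
          congr 1
          field_simp
          ring
        · rw [Set.indicator_of_notMem hy]
          have : (fun x : ℝ => (x, y)) ⁻¹' boxSet M a b = ∅ := by
            ext x
            simp only [Set.mem_preimage, Set.mem_empty_iff_false, iff_false]
            rintro ⟨_, _, h1, h2, _⟩
            exact hy ⟨h1, h2⟩
          show volume ((fun x : ℝ => (x, y)) ⁻¹' boxSet M a b) ≤ 0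
          rw [this]; simp
    _ = ENNReal.ofReal (2 * M / b) := by
        rw [lintegral_indicator measurableSet_Icc, setLIntegral_const, Real.volume_Icc,
          ← ENNReal.ofReal_mul (by positivity)]
        congr 1
        ring

lemma boxSet_comparable (M : ℝ) (hM : 1 ≤ M) (a b : ℕ) (ha : 1 ≤ a) (hb : 1 ≤ b)
    (h : (boxSet M a b).Nonempty) :
    (a : ℝ) ≤ M * (M + 2) * b ∧ (b : ℝ) ≤ M * (M + 2) * a := by
  obtain ⟨⟨u, v⟩, h1, h2, h3, h4, h5⟩ := h
  have h' := Int.floor_eq_iff.1 h5.symm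
  simp only [Int.cast_natCast] at h' h1 h2 h3 h4
  have ha' : (1 : ℝ) ≤ a := by exact_mod_cast ha
  have hb' : (1 : ℝ) ≤ b := by exact_mod_cast hb
  constructor
  · have : u * b ≤ M * b := by gcongr
    have : v ≤ M * b := by nlinarith
    have : 0 ≤ M * M * b := by positivity
    nlinarith
  · have e1 : 1 / M * b ≤ u * b := by gcongr
    have e2 : (b : ℝ) = M * (1 / M * b) := by field_simp
    have e3 : 1 / M * b ≤ (M + 2) * a := by nlinarith
    calc (b : ℝ) = M * (1 / M * b) := e2
      _ ≤ M * ((M + 2) * a) := by gcongr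
      _ = _ := by ring

lemma rpow_ratio_le (K t x : ℝ) (hK : 1 ≤ K) (hx : 0 < x) (h1 : x ≤ K) (h2 : 1 / K ≤ x) :
    x ^ t ≤ K ^ |t| := by
  rcases le_total 0 t with ht | ht
  · rw [abs_of_nonneg ht]; gcongr
  · rw [abs_of_nonpos ht, Real.rpow_neg (by linarith), ← Real.inv_rpow (by linarith)]
    apply Real.rpow_le_rpow_of_nonpos (by positivity) _ ht
    simpa using h2

lemma weight_le (K p q s a b : ℝ) (hK : 1 ≤ K) (ha : 1 ≤ a) (hb : 1 ≤ b)
    (hs : p + q - 1 ≤ s) (h1 : a ≤ K * b) (h2 : b ≤ K * a) :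
    a ^ (-s) / b ≤ K ^ |1 - q| * (a ^ (-p) * b ^ (-q)) := by
  have ha0 : 0 < a := by linarith
  have hb0 : 0 < b := by linarith
  have hr := rpow_ratio_le K (1 - q) (a / b) hK (by positivity)
    ((div_le_iff₀ hb0).2 h1) (by
      rw [div_le_div_iff₀ (by linarith) hb0]; linarith)
  calc a ^ (-s) / b ≤ a ^ (-p + (1 - q)) / b := by
        gcongr
        linarith
    _ = (a / b) ^ (1 - q) * (a ^ (-p) * b ^ (-q)) := by
        rw [Real.rpow_add ha0, Real.div_rpow ha0.le hb0.le, Real.rpow_sub hb0,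
          Real.rpow_neg hb0.le q, Real.rpow_one]
        have := Real.rpow_pos_of_pos hb0 q
        field_simp
    _ ≤ _ := by gcongr

open Classical in
/-- The weights. -/
noncomputable def wt (A B : Set ℕ) (s : ℝ) (x : ℕ × ℕ) : ENNReal :=
  if x.1 ∈ A ∩ Set.Ici 1 ∧ x.2 ∈ B ∩ Set.Ici 1 then ENNReal.ofReal ((x.1 : ℝ) ^ (-s)) else 0

lemma ae_box (A B : Set ℕ) (M : ℝ) (hM : 1 ≤ M) (s : ℝ)
    (hs : max 0 (massDimN A + massDimN B - 1) < s) :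
    ∀ᵐ x : ℝ × ℝ, ∑' i : ℕ × ℕ, (boxSet M i.1 i.2).indicator (fun _ => wt A B s i) x < ⊤ := by
  have hs2 : massDimN A + massDimN B - 1 < s := (le_max_right _ _).trans_lt hs
  set ε := (s - (massDimN A + massDimN B - 1)) / 2 with hε
  have hε0 : 0 < ε := by linarith
  have hA := massDimN_summable A (massDimN A + ε) (by linarith)
  have hB := massDimN_summable B (massDimN B + ε) (by linarith)
  set p := massDimN A + ε
  set q := massDimN B + ε
  have hpq : p + q - 1 ≤ s := by simp only [p, q]; linarith
  have hprod := Summable.mul_of_nonneg hA hB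
    (fun a => Set.indicator_nonneg (fun a _ => by positivity) a)
    (fun a => Set.indicator_nonneg (fun a _ => by positivity) a)
  set K := M * (M + 2)
  have hK : 1 ≤ K := by simp only [K]; nlinarith
  have hprod2 := hprod.mul_left (2 * M * K ^ |1 - q|)
  apply ae_lt_top
  · exact Measurable.ennreal_tsum fun i => measurable_const.indicator (boxSet_meas M _ _)
  rw [lintegral_tsum fun i => (measurable_const.indicator (boxSet_meas M _ _)).aemeasurable]
  refine ne_top_of_le_ne_top hprod2.tsum_ofReal_ne_top ?_
  apply ENNReal.tsum_le_tsum
  rintro ⟨a, b⟩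
  rw [lintegral_indicator (boxSet_meas M _ _), setLIntegral_const]
  unfold wt
  split_ifs with hab
  · rw [Set.indicator_of_mem hab.1, Set.indicator_of_mem hab.2]
    have ha : 1 ≤ a := hab.1.2
    have hb : 1 ≤ b := hab.2.2
    have hb0 : (0 : ℝ) < b := by exact_mod_cast hb
    rcases (boxSet M a b).eq_empty_or_nonempty with he | hne
    · simp [he]
    obtain ⟨c1, c2⟩ := boxSet_comparable M hM a b ha hb hne
    calc _ ≤ ENNReal.ofReal ((a : ℝ) ^ (-s)) * ENNReal.ofReal (2 * M / b) := by
          gcongr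
          exact boxSet_vol M (by linarith) a b hb
      _ = ENNReal.ofReal (2 * M * ((a : ℝ) ^ (-s) / b)) := by
          rw [← ENNReal.ofReal_mul (by positivity)]
          congr 1
          ring
      _ ≤ _ := by
          apply ENNReal.ofReal_le_ofReal
          rw [mul_assoc (2 * M) (K ^ |1 - q|)]
          apply mul_le_mul_of_nonneg_left _ (by linarith)
          exact weight_le K p q s a b hK (by exact_mod_cast ha) (by exact_mod_cast hb) hpq c1 c2
  · simp

lemma dim_le_of_finite_sum (A B : Set ℕ) (M : ℝ) (s : ℝ) (hs : 0 < s) (u v : ℝ)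
    (h1 : 1 / M ≤ u) (h2 : u ≤ M) (h3 : -M ≤ v) (h4 : v ≤ M)
    (h : ∑' i : ℕ × ℕ, (boxSet M i.1 i.2).indicator (fun _ => wt A B s i) (u, v) < ⊤) :
    massDimN (interFloor A B u v) ≤ s := by
  set F := ∑' i : ℕ × ℕ, (boxSet M i.1 i.2).indicator (fun _ => wt A B s i) (u, v) with hF
  apply massDimN_le_of_count _ (F.toReal + 1) s hs.le
  intro N hN
  have hNpos : (0 : ℝ) < N := by exact_mod_cast hN
  have hN1 : (1 : ℝ) ≤ (N : ℝ) ^ s := Real.one_le_rpow (by exact_mod_cast hN) hs.le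
  set S := interFloor A B u v ∩ Set.Icc 1 N with hS
  have hSfin : S.Finite := (Set.finite_Icc 1 N).subset Set.inter_subset_right
  set T := hSfin.toFinset.erase (⌊v⌋).toNat with hT
  have hmem : ∀ a ∈ T, ∃ b : ℕ, a ∈ A ∧ 1 ≤ a ∧ a ≤ N ∧ b ∈ B ∧ 1 ≤ b ∧
      (a : ℤ) = ⌊u * (b : ℝ) + v⌋ := by
    intro a ha
    rw [hT, Finset.mem_erase, Set.Finite.mem_toFinset] at ha
    obtain ⟨hne, ⟨haA, b, hbB, hb⟩, ha1, haN⟩ := ha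
    refine ⟨b, haA, ha1, haN, hbB, ?_, hb⟩
    by_contra hb0
    have : b = 0 := by omega
    subst this
    simp at hb
    omega
  choose! g hg using hmem
  have hle : ∑ a ∈ T, ENNReal.ofReal ((N : ℝ) ^ (-s)) ≤ F := by
    calc ∑ a ∈ T, ENNReal.ofReal ((N : ℝ) ^ (-s))
        ≤ ∑ a ∈ T, (boxSet M a (g a)).indicator (fun _ => wt A B s (a, g a)) (u, v) := by
          apply Finset.sum_le_sum
          intro a ha
          obtain ⟨k1, k2, k3, k4, k5, k6⟩ := hg a ha
          rw [Set.indicator_of_mem (show (u, v) ∈ boxSet M a (g a) from ⟨h1, h2, h3, h4, k6⟩)]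
          unfold wt
          rw [if_pos ⟨⟨k1, k2⟩, ⟨k4, k5⟩⟩]
          apply ENNReal.ofReal_le_ofReal
          apply Real.rpow_le_rpow_of_nonpos (by exact_mod_cast k2) (by exact_mod_cast k3)
          linarith
      _ = ∑ i ∈ T.image (fun a => (a, g a)),
            (boxSet M i.1 i.2).indicator (fun _ => wt A B s i) (u, v) := by
          rw [Finset.sum_image]
          intro a _ b _ hab
          exact (Prod.mk.inj hab).1
      _ ≤ F := ENNReal.sum_le_tsum _
  rw [Finset.sum_const, nsmul_eq_mul] at hle
  have hle2 := ENNReal.toReal_mono h.ne hle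
  rw [ENNReal.toReal_mul, ENNReal.toReal_natCast, ENNReal.toReal_ofReal (by positivity),
    Real.rpow_neg hNpos.le, ← div_eq_mul_inv, div_le_iff₀ (by positivity)] at hle2
  have hcard : S.ncard ≤ T.card + 1 := by
    rw [Set.ncard_eq_toFinset_card S hSfin]
    have := Finset.pred_card_le_card_erase (s := hSfin.toFinset) (a := (⌊v⌋).toNat)
    rw [← hT] at this
    omega
  have hcard' : (S.ncard : ℝ) ≤ T.card + 1 := by exact_mod_cast hcard
  linarith

lemma dim_le_of_nonpos (A B : Set ℕ) (u v : ℝ) (hu : u ≤ 0) :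
    massDimN (interFloor A B u v) ≤ 0 := by
  apply massDimN_le_of_count _ (⌊v⌋.toNat : ℝ) 0 le_rfl
  intro N hN
  rw [Real.rpow_zero, mul_one]
  have hsub : interFloor A B u v ∩ Set.Icc 1 N ⊆ Set.Icc 1 ⌊v⌋.toNat := by
    rintro a ⟨⟨_, b, _, hb⟩, ha, _⟩
    refine ⟨ha, ?_⟩
    have : ⌊u * (b : ℝ) + v⌋ ≤ ⌊v⌋ := Int.floor_le_floor (by
      have : u * (b : ℝ) ≤ 0 := mul_nonpos_of_nonpos_of_nonneg hu (by positivity)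
      linarith)
    omega
  have h := Set.ncard_le_ncard hsub (Set.finite_Icc _ _)
  have h2 : (Set.Icc 1 ⌊v⌋.toNat).ncard = ⌊v⌋.toNat := by
    rw [← Finset.coe_Icc, Set.ncard_coe_finset]; simp
  rw [h2] at h
  exact_mod_cast h

/-- For `A, B ⊆ ℕ`, for Lebesgue-a.e. `(u,v) ∈ ℝ²`,
`D̄(A ∩ ⌊uB + v⌋) ≤ max(0, D̄(A) + D̄(B) - 1)`. -/
theorem final_corollary (A B : Set ℕ) :
    ∀ᵐ uv : ℝ × ℝ, massDimN (interFloor A B uv.1 uv.2) ≤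
      max 0 (massDimN A + massDimN B - 1) := by
  set γ := max 0 (massDimN A + massDimN B - 1) with hγ
  have hγ0 : 0 ≤ γ := le_max_left _ _
  have hae : ∀ᵐ x : ℝ × ℝ, ∀ m n : ℕ,
      ∑' i : ℕ × ℕ, (boxSet ((m : ℝ) + 1) i.1 i.2).indicator
        (fun _ => wt A B (γ + 1 / ((n : ℝ) + 1)) i) x < ⊤ := by
    rw [ae_all_iff]; intro m
    rw [ae_all_iff]; intro n
    apply ae_box A B _ (by simp) 
    rw [← hγ]
    have : (0 : ℝ) < 1 / ((n : ℝ) + 1) := by positivity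
    linarith
  filter_upwards [hae]
  rintro ⟨u, v⟩ hx
  dsimp only
  rcases le_or_gt u 0 with hu | hu
  · exact (dim_le_of_nonpos A B u v hu).trans hγ0
  apply le_of_forall_pos_le_add
  intro δ hδ
  obtain ⟨n, hn⟩ := exists_nat_one_div_lt hδ
  obtain ⟨m, hm⟩ := exists_nat_ge (max (max u (1 / u)) |v|)
  have hm1 : u ≤ m := (le_max_left _ _).trans ((le_max_left _ _).trans hm)
  have hm2 : 1 / u ≤ m := (le_max_right _ _).trans ((le_max_left _ _).trans hm)
  have hm3 : |v| ≤ m := (le_max_right _ _).trans hm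
  have hm4 := abs_le.1 hm3
  have hn0 : (0 : ℝ) < 1 / ((n : ℝ) + 1) := by positivity
  refine (dim_le_of_finite_sum A B ((m : ℝ) + 1) (γ + 1 / ((n : ℝ) + 1)) (by linarith) u v
    ?_ (by linarith) (by linarith) (by linarith) (hx m n)).trans (by linarith)
  rw [div_le_iff₀ hu] at hm2
  rw [div_le_iff₀ (by positivity)]
  linarith
end

section
/- Let E ⊆ ℕ², and let U be the set of parameter pairs (u,v) with u,v > 0 such that D̄(E ∩ ⌊l_{u,v}⌋) ≤ max(0, D̄(E) − 1). Then the Lebesgue (outer) measure of U ∩ [0,M]² divided by M² tends to 1 as M → ∞. -/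
open Filter MeasureTheory Set

/-- The mass dimension of `E ⊆ ℕ²`: `limsup_{N → ∞} log |E ∩ [0,N]²| / log N`. -/
noncomputable def massDim2 (E : Set (ℕ × ℕ)) : ℝ :=
  Filter.limsup (fun N : ℕ =>
    Real.log ((E ∩ (Set.Icc 0 N ×ˢ Set.Icc 0 N)).ncard) / Real.log N) Filter.atTop

/-- The slice `E ∩ ⌊l_{u,v}⌋ = {y ∈ ℕ : ∃ x, (x,y) ∈ E ∧ y = ⌊u·x + v⌋}`. -/
def sliceFloor (E : Set (ℕ × ℕ)) (u v : ℝ) : Set ℕ :=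
  {y : ℕ | ∃ x : ℕ, (x, y) ∈ E ∧ (y : ℤ) = ⌊u * (x : ℝ) + v⌋}

/-- Polynomial bound on box counts from the mass dimension. -/
lemma box_count_bound (E : Set (ℕ × ℕ)) (t : ℝ) (ht0 : 0 ≤ t) (ht : massDim2 E < t) :
    ∃ C : ℝ, 0 ≤ C ∧ ∀ n : ℕ, 1 ≤ n →
      ((E ∩ (Set.Icc 0 n ×ˢ Set.Icc 0 n)).ncard : ℝ) ≤ C * (n : ℝ) ^ t := by
  have hfin : ∀ n : ℕ, ((Set.Icc 0 n ×ˢ Set.Icc 0 n) : Set (ℕ × ℕ)).Finite :=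
    fun n => (Set.finite_Icc 0 n).prod (Set.finite_Icc 0 n)
  have hcard : ∀ n : ℕ, (E ∩ (Set.Icc 0 n ×ˢ Set.Icc 0 n)).ncard ≤ (n + 1) ^ 2 := by
    intro n
    refine (Set.ncard_le_ncard Set.inter_subset_right (hfin n)).trans ?_
    rw [Set.ncard_prod]
    simp [Set.ncard_eq_toFinset_card', sq]
  have hb : Filter.IsBoundedUnder (· ≤ ·) Filter.atTop (fun N : ℕ =>
      Real.log ((E ∩ (Set.Icc 0 N ×ˢ Set.Icc 0 N)).ncard) / Real.log N) := by
    refine Filter.isBoundedUnder_of_eventually_le (a := 4) ?_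
    filter_upwards [Filter.eventually_ge_atTop 2] with N hN
    have hN' : (2 : ℝ) ≤ N := by exact_mod_cast hN
    have hlog : 0 < Real.log N := Real.log_pos (by linarith)
    rw [div_le_iff₀ hlog]
    rcases Nat.eq_zero_or_pos (E ∩ (Set.Icc 0 N ×ˢ Set.Icc 0 N)).ncard with h0 | h0
    · rw [h0]; simp; positivity
    · have h1 : ((E ∩ (Set.Icc 0 N ×ˢ Set.Icc 0 N)).ncard : ℝ) ≤ (N : ℝ) ^ 4 := by
        have h2 : ((E ∩ (Set.Icc 0 N ×ˢ Set.Icc 0 N)).ncard : ℝ) ≤ ((N : ℝ) + 1) ^ 2 := by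
          exact_mod_cast hcard N
        have h3 : (N : ℝ) + 1 ≤ (N : ℝ) ^ 2 := by nlinarith
        calc _ ≤ ((N : ℝ) + 1) ^ 2 := h2
          _ ≤ ((N : ℝ) ^ 2) ^ 2 := by gcongr
          _ = _ := by ring
      have := Real.log_le_log (by exact_mod_cast h0) h1
      rw [Real.log_pow] at this
      exact_mod_cast this
  have hev := Filter.eventually_lt_of_limsup_lt (show Filter.limsup _ _ < t from ht) hb
  obtain ⟨N₀, hN₀⟩ := Filter.eventually_atTop.1 hev
  set N₁ := max N₀ 2 with hN₁
  refine ⟨max 1 ((E ∩ (Set.Icc 0 N₁ ×ˢ Set.Icc 0 N₁)).ncard : ℝ), by positivity, ?_⟩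
  intro n hn
  have hn1 : (1 : ℝ) ≤ n := by exact_mod_cast hn
  have hpow : 1 ≤ (n : ℝ) ^ t := Real.one_le_rpow hn1 ht0
  by_cases h : N₁ ≤ n
  · have hn2 : (2 : ℝ) ≤ n := by exact_mod_cast (le_max_right _ _).trans h
    have hlog : 0 < Real.log n := Real.log_pos (by linarith)
    have h1 := hN₀ n ((le_max_left _ _).trans h)
    rw [div_lt_iff₀ hlog] at h1
    have h2 : ((E ∩ (Set.Icc 0 n ×ˢ Set.Icc 0 n)).ncard : ℝ) ≤ (n : ℝ) ^ t := by
      rcases Nat.eq_zero_or_pos (E ∩ (Set.Icc 0 n ×ˢ Set.Icc 0 n)).ncard with h0 | h0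
      · rw [h0]; push_cast; positivity
      · rw [← Real.log_le_log_iff (by exact_mod_cast h0) (by positivity),
          Real.log_rpow (by linarith)]
        exact h1.le
    calc _ ≤ (n : ℝ) ^ t := h2
      _ = 1 * (n : ℝ) ^ t := by ring
      _ ≤ _ := by gcongr; exact le_max_left _ _
  · have h2 : ((E ∩ (Set.Icc 0 n ×ˢ Set.Icc 0 n)).ncard : ℝ) ≤
        (E ∩ (Set.Icc 0 N₁ ×ˢ Set.Icc 0 N₁)).ncard := by
      have : (E ∩ (Set.Icc 0 n ×ˢ Set.Icc 0 n)) ⊆ (E ∩ (Set.Icc 0 N₁ ×ˢ Set.Icc 0 N₁)) := by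
        rintro ⟨a, b⟩ ⟨h1, h2⟩
        refine ⟨h1, ?_⟩
        simp only [Set.mem_prod, Set.mem_Icc] at h2 ⊢
        omega
      exact_mod_cast Set.ncard_le_ncard this ((hfin N₁).subset Set.inter_subset_right)
    calc _ ≤ max 1 ((E ∩ (Set.Icc 0 N₁ ×ˢ Set.Icc 0 N₁)).ncard : ℝ) := h2.trans (le_max_right _ _)
      _ = _ * 1 := by ring
      _ ≤ _ := by gcongr

/-- Convergence of the Dirichlet series over `E`. -/
lemma series_finite (E : Set (ℕ × ℕ)) (p : ℝ) (hp0 : 0 < p) (hp : massDim2 E < p) :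
    ∑' q : ℕ × ℕ, (E ∩ {q | 1 ≤ q.1}).indicator
      (fun q => ENNReal.ofReal (((max q.1 q.2 : ℕ) : ℝ) ^ (-p))) q ≠ ⊤ := by
  obtain ⟨t, ht1, ht2⟩ : ∃ t, max (massDim2 E) 0 < t ∧ t < p :=
    exists_between (max_lt hp hp0)
  have ht0 : 0 < t := (le_max_right _ _).trans_lt ht1
  obtain ⟨C, hC0, hC⟩ := box_count_bound E t ht0.le ((le_max_left _ _).trans_lt ht1)
  set B : ℕ → Set (ℕ × ℕ) := fun k =>
    E ∩ (Set.Icc 0 (2 ^ (k + 1)) ×ˢ Set.Icc 0 (2 ^ (k + 1))) with hB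
  have hBfin : ∀ k, (B k).Finite := fun k =>
    ((Set.finite_Icc _ _).prod (Set.finite_Icc _ _)).subset Set.inter_subset_right
  have step1 : ∀ q : ℕ × ℕ, (E ∩ {q | 1 ≤ q.1}).indicator
      (fun q => ENNReal.ofReal (((max q.1 q.2 : ℕ) : ℝ) ^ (-p))) q ≤
      ∑' k : ℕ, (B k).indicator (fun _ => ENNReal.ofReal (((2 : ℝ) ^ k) ^ (-p))) q := by
    intro q
    by_cases hq : q ∈ E ∩ {q | 1 ≤ q.1}
    · rw [Set.indicator_of_mem hq]
      set r := max q.1 q.2 with hr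
      have hr1 : 1 ≤ r := le_trans hq.2 (le_max_left _ _)
      refine le_trans ?_ (ENNReal.le_tsum (Nat.log 2 r))
      have hlt : r < 2 ^ (Nat.log 2 r + 1) := Nat.lt_pow_succ_log_self (by norm_num) r
      have hle : 2 ^ (Nat.log 2 r) ≤ r := Nat.pow_log_le_self 2 (by omega)
      have hmem : q ∈ B (Nat.log 2 r) := by
        refine ⟨hq.1, ?_⟩
        simp only [Set.mem_prod, Set.mem_Icc]
        have := le_max_left q.1 q.2
        have := le_max_right q.1 q.2
        refine ⟨⟨by omega, by omega⟩, by omega, by omega⟩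
      rw [Set.indicator_of_mem hmem]
      apply ENNReal.ofReal_le_ofReal
      apply Real.rpow_le_rpow_of_nonpos (by positivity)
      · exact_mod_cast hle
      · linarith
    · rw [Set.indicator_of_notMem hq]; exact zero_le
  have step2 : ∀ k : ℕ, ∑' q : ℕ × ℕ,
      (B k).indicator (fun _ => ENNReal.ofReal (((2 : ℝ) ^ k) ^ (-p))) q ≤
      ENNReal.ofReal (C * 2 ^ t * ((2 : ℝ) ^ (t - p)) ^ k) := by
    intro k
    rw [← tsum_subtype, ENNReal.tsum_set_const, ← (hBfin k).cast_ncard_eq]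
    have h1 : ((B k).ncard : ℝ) ≤ C * ((2 ^ (k + 1) : ℕ) : ℝ) ^ t := hC _ Nat.one_le_two_pow
    have h2 : (((B k).ncard : ℕ∞) : ENNReal) = ENNReal.ofReal ((B k).ncard : ℝ) := by
      rw [ENat.toENNReal_coe, ENNReal.ofReal_natCast]
    rw [h2, ← ENNReal.ofReal_mul (by positivity)]
    apply ENNReal.ofReal_le_ofReal
    have e1 : ((2 ^ (k + 1) : ℕ) : ℝ) ^ t = 2 ^ t * ((2 : ℝ) ^ t) ^ k := by
      push_cast
      rw [pow_succ, Real.mul_rpow (by positivity) (by norm_num), mul_comm,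
        ← Real.rpow_natCast, ← Real.rpow_natCast, ← Real.rpow_mul (by norm_num),
        ← Real.rpow_mul (by norm_num), mul_comm t]
    have e2 : ((2 : ℝ) ^ k) ^ (-p) = ((2 : ℝ) ^ (-p)) ^ k := by
      rw [← Real.rpow_natCast, ← Real.rpow_natCast, ← Real.rpow_mul (by norm_num),
        ← Real.rpow_mul (by norm_num), mul_comm]
    rw [e1] at h1
    rw [e2, sub_eq_add_neg, Real.rpow_add (by norm_num), mul_pow]
    calc _ ≤ (C * (2 ^ t * ((2 : ℝ) ^ t) ^ k)) * ((2 : ℝ) ^ (-p)) ^ k := by gcongr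
      _ = _ := by ring
  have hsum : Summable (fun k : ℕ => C * 2 ^ t * ((2 : ℝ) ^ (t - p)) ^ k) := by
    apply Summable.mul_left
    apply summable_geometric_of_lt_one (by positivity)
    exact Real.rpow_lt_one_of_one_lt_of_neg (by norm_num) (by linarith)
  refine ne_top_of_le_ne_top hsum.tsum_ofReal_ne_top ?_
  calc _ ≤ ∑' q : ℕ × ℕ, ∑' k : ℕ,
        (B k).indicator (fun _ => ENNReal.ofReal (((2 : ℝ) ^ k) ^ (-p))) q :=
        ENNReal.tsum_le_tsum step1
    _ = ∑' k : ℕ, ∑' q : ℕ × ℕ,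
        (B k).indicator (fun _ => ENNReal.ofReal (((2 : ℝ) ^ k) ^ (-p))) q := ENNReal.tsum_comm
    _ ≤ _ := ENNReal.tsum_le_tsum step2

/-- parameters whose line passes through `q`. -/
def hitSet (q : ℕ × ℕ) : Set (ℝ × ℝ) := {w | (q.2 : ℤ) = ⌊w.1 * (q.1 : ℝ) + w.2⌋}

lemma measurableSet_hitSet (q : ℕ × ℕ) : MeasurableSet (hitSet q) := by
  have : Measurable (fun w : ℝ × ℝ => ⌊w.1 * (q.1 : ℝ) + w.2⌋) := by fun_prop
  exact measurableSet_eq_fun measurable_const this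

lemma hitSet_measure (q : ℕ × ℕ) (hq : 1 ≤ q.1) (M : ℕ) :
    volume (hitSet q ∩ (Set.Icc 0 (M : ℝ) ×ˢ Set.Icc 0 (M : ℝ))) ≤
      ENNReal.ofReal (M * (q.1 : ℝ)⁻¹) := by
  have hx : (0 : ℝ) < q.1 := by exact_mod_cast hq
  have hm : MeasurableSet (hitSet q ∩ (Set.Icc 0 (M : ℝ) ×ˢ Set.Icc 0 (M : ℝ))) :=
    (measurableSet_hitSet q).inter (measurableSet_Icc.prod measurableSet_Icc)
  rw [Measure.volume_eq_prod, Measure.prod_apply_symm hm]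
  calc _ ≤ ∫⁻ v : ℝ, (Set.Icc 0 (M : ℝ)).indicator (fun _ => ENNReal.ofReal (q.1 : ℝ)⁻¹) v := by
        apply lintegral_mono
        intro v
        by_cases hv : v ∈ Set.Icc 0 (M : ℝ)
        · simp only [Set.indicator_of_mem hv]
          have hsub : (fun x => (x, v)) ⁻¹' (hitSet q ∩ (Set.Icc 0 (M : ℝ) ×ˢ Set.Icc 0 (M : ℝ))) ⊆
              Set.Icc (((q.2 : ℝ) - v) / q.1) (((q.2 : ℝ) + 1 - v) / q.1) := by
            intro u hu
            have h1 : (q.2 : ℤ) = ⌊u * (q.1 : ℝ) + v⌋ := hu.1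
            have h2 := Int.floor_eq_iff.1 h1.symm
            push_cast at h2
            constructor
            · rw [div_le_iff₀ hx]; linarith [h2.1]
            · rw [le_div_iff₀ hx]; linarith [h2.2]
          refine (measure_mono hsub).trans ?_
          rw [Real.volume_Icc]
          apply le_of_eq
          congr 1
          field_simp
          ring
        · simp only [Set.indicator_of_notMem hv]
          have : (fun x => (x, v)) ⁻¹' (hitSet q ∩ (Set.Icc 0 (M : ℝ) ×ˢ Set.Icc 0 (M : ℝ))) = ∅ := by
            ext u
            simp only [Set.mem_preimage, Set.mem_empty_iff_false, iff_false]
            intro hu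
            exact hv hu.2.2
          rw [this, measure_empty]
    _ = _ := by
        rw [lintegral_indicator_const measurableSet_Icc, Real.volume_Icc,
          ← ENNReal.ofReal_mul (by positivity)]
        congr 1
        ring

/-- If slice counts are `O(N^s)`, the dimension is at most `s`. -/
lemma massDimN_le_of_bound (A : Set ℕ) (s B : ℝ) (hB : 0 < B)
    (h : ∀ N : ℕ, 1 ≤ N → ((A ∩ Set.Icc 1 N).ncard : ℝ) ≤ B * (N : ℝ) ^ s) (s' : ℝ)
    (hs0 : 0 ≤ s) (hs' : s < s') : massDimN A ≤ s' := by
  unfold massDimN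
  apply Filter.limsup_le_of_le
  · apply Filter.IsBoundedUnder.isCoboundedUnder_le
    refine Filter.isBoundedUnder_of_eventually_ge (a := 0) ?_
    filter_upwards [] with N
    apply div_nonneg (Real.log_natCast_nonneg _) (Real.log_natCast_nonneg _)
  · have hl : Tendsto (fun N : ℕ => Real.log N) atTop atTop :=
      Real.tendsto_log_atTop.comp tendsto_natCast_atTop_atTop
    filter_upwards [hl.eventually_ge_atTop (Real.log B / (s' - s)),
      Filter.eventually_ge_atTop 2] with N hN1 hN2
    have hN' : (2 : ℝ) ≤ N := by exact_mod_cast hN2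
    have hlog : 0 < Real.log N := Real.log_pos (by linarith)
    rw [div_le_iff₀ hlog]
    rcases Nat.eq_zero_or_pos (A ∩ Set.Icc 1 N).ncard with h0 | h0
    · rw [h0]; simp; exact mul_nonneg (by linarith) hlog.le
    · have h1 := Real.log_le_log (by exact_mod_cast h0) (h N (by omega))
      rw [Real.log_mul hB.ne' (by positivity), Real.log_rpow (by linarith)] at h1
      rw [div_le_iff₀ (by linarith)] at hN1
      linarith

/-- Deterministic count: a finite weighted sum bounds the slice. -/
lemma slice_dim_le (E : Set (ℕ × ℕ)) (s : ℝ) (hs : 0 < s) (u v : ℝ) (hu : 0 < u) (hv : 0 < v)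
    (hfin : ∑' q : ℕ × ℕ, (E ∩ {q | 1 ≤ q.1} ∩ {q | (u, v) ∈ hitSet q}).indicator
      (fun q => ENNReal.ofReal ((q.1 : ℝ) ^ (-s))) q ≠ ⊤) (s' : ℝ) (hs' : s < s') :
    massDimN (sliceFloor E u v) ≤ s' := by
  set f : ℕ × ℕ → ENNReal := (E ∩ {q | 1 ≤ q.1} ∩ {q | (u, v) ∈ hitSet q}).indicator
      (fun q => ENNReal.ofReal ((q.1 : ℝ) ^ (-s))) with hf
  set S := (∑' q, f q).toReal with hS
  have hS0 : 0 ≤ S := ENNReal.toReal_nonneg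
  refine massDimN_le_of_bound _ s (1 + S * (2 / u) ^ s) (by positivity) ?_ s' hs.le hs'
  intro N hN
  have hN1 : (1 : ℝ) ≤ N := by exact_mod_cast hN
  set A := sliceFloor E u v ∩ Set.Icc 1 N with hA
  have hAfin : A.Finite := (Set.finite_Icc 1 N).subset Set.inter_subset_right
  set G := A \ {⌊v⌋.toNat} with hG
  have hGfin : G.Finite := hAfin.subset Set.sdiff_subset
  have hAG : A.ncard ≤ G.ncard + 1 := by
    have := Set.ncard_le_ncard_sdiff_add_ncard A {⌊v⌋.toNat} (Set.finite_singleton _)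
    simpa using this
  have hex : ∀ y : G, ∃ x : ℕ, (x, (y : ℕ)) ∈ E ∧ ((y : ℕ) : ℤ) = ⌊u * (x : ℝ) + v⌋ :=
    fun y => y.2.1.1
  choose x hxE hxf using hex
  have hx1 : ∀ y : G, 1 ≤ x y := by
    intro y
    by_contra hcon
    have h0 : x y = 0 := by omega
    have h1 := hxf y
    rw [h0] at h1
    simp only [Nat.cast_zero, mul_zero, zero_add] at h1
    apply y.2.2
    simp only [Set.mem_singleton_iff]
    omega
  have hxle : ∀ y : G, (x y : ℝ) ≤ 2 / u * N := by
    intro y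
    have h2 := (Int.floor_eq_iff.1 (hxf y).symm).2
    push_cast at h2
    have h3 : ((y : ℕ) : ℝ) ≤ N := by exact_mod_cast y.2.1.2.2
    rw [div_mul_eq_mul_div, le_div_iff₀ hu]
    nlinarith
  have hinj : Function.Injective (fun y : G => (x y, (y : ℕ))) := by
    intro a b hab
    exact Subtype.ext (Prod.ext_iff.1 hab).2
  have hlow : ∀ y : G, ENNReal.ofReal ((2 / u * N : ℝ) ^ (-s)) ≤ f (x y, (y : ℕ)) := by
    intro y
    have hmem : (x y, (y : ℕ)) ∈ (E ∩ {q | 1 ≤ q.1} ∩ {q | (u, v) ∈ hitSet q}) :=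
      ⟨⟨hxE y, hx1 y⟩, hxf y⟩
    rw [hf, Set.indicator_of_mem hmem]
    apply ENNReal.ofReal_le_ofReal
    apply Real.rpow_le_rpow_of_nonpos _ (hxle y) (by linarith)
    exact_mod_cast hx1 y
  have hsum : (G.ncard : ENNReal) * ENNReal.ofReal ((2 / u * N : ℝ) ^ (-s)) ≤ ∑' q, f q := by
    calc _ = ∑' y : G, ENNReal.ofReal ((2 / u * N : ℝ) ^ (-s)) := by
          rw [ENNReal.tsum_set_const, ← hGfin.cast_ncard_eq, ENat.toENNReal_coe]
      _ ≤ ∑' y : G, f (x y, (y : ℕ)) := ENNReal.tsum_le_tsum hlow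
      _ ≤ _ := ENNReal.tsum_comp_le_tsum_of_injective hinj f
  have hreal := ENNReal.toReal_mono hfin hsum
  rw [ENNReal.toReal_mul, ENNReal.toReal_natCast,
    ENNReal.toReal_ofReal (by positivity), Real.rpow_neg (by positivity),
    ← div_eq_mul_inv, div_le_iff₀ (by positivity),
    Real.mul_rpow (by positivity) (by positivity)] at hreal
  have hpow : 1 ≤ (N : ℝ) ^ s := Real.one_le_rpow hN1 hs.le
  have hAG' : (A.ncard : ℝ) ≤ G.ncard + 1 := by exact_mod_cast hAG
  change (G.ncard : ℝ) ≤ S * _ at hreal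
  linarith

/-- Almost sure bound in a box. -/
lemma ae_box_s3 (E : Set (ℕ × ℕ)) (s : ℝ) (hs : 0 < s) (hs1 : massDim2 E < s + 1) (M : ℕ)
    (hM : 1 ≤ M) :
    ∀ᵐ w : ℝ × ℝ ∂(volume.restrict (Set.Icc 0 (M : ℝ) ×ˢ Set.Icc 0 (M : ℝ))),
      ∑' q : ℕ × ℕ, (E ∩ {q | 1 ≤ q.1} ∩ {q | w ∈ hitSet q}).indicator
      (fun q => ENNReal.ofReal ((q.1 : ℝ) ^ (-s))) q ≠ ⊤ := by
  have hM1 : (1 : ℝ) ≤ M := by exact_mod_cast hM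
  set g : ℕ × ℕ → ENNReal := (E ∩ {q | 1 ≤ q.1}).indicator
      (fun q => ENNReal.ofReal ((q.1 : ℝ) ^ (-s))) with hg
  have hform : ∀ (w : ℝ × ℝ) (q : ℕ × ℕ),
      (E ∩ {q | 1 ≤ q.1} ∩ {q | w ∈ hitSet q}).indicator
        (fun q => ENNReal.ofReal ((q.1 : ℝ) ^ (-s))) q = (hitSet q).indicator (fun _ => g q) w := by
    intro w q
    by_cases h1 : w ∈ hitSet q <;> by_cases h2 : q ∈ E ∩ {q | 1 ≤ q.1}
    · rw [Set.indicator_of_mem h1, hg, Set.indicator_of_mem h2, Set.indicator_of_mem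
        (show q ∈ E ∩ {q | 1 ≤ q.1} ∩ {q | w ∈ hitSet q} from ⟨h2, h1⟩)]
    · rw [Set.indicator_of_mem h1, hg, Set.indicator_of_notMem h2,
        Set.indicator_of_notMem (fun h => h2 h.1)]
    · rw [Set.indicator_of_notMem h1, Set.indicator_of_notMem (fun h => h1 h.2)]
    · rw [Set.indicator_of_notMem h1, Set.indicator_of_notMem (fun h => h1 h.2)]
  simp only [hform]
  have hmeas : ∀ q : ℕ × ℕ, Measurable ((hitSet q).indicator (fun _ : ℝ × ℝ => g q)) :=
    fun q => measurable_const.indicator (measurableSet_hitSet q)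
  have hint : ∫⁻ w : ℝ × ℝ, ∑' q, (hitSet q).indicator (fun _ => g q) w
      ∂(volume.restrict (Set.Icc 0 (M : ℝ) ×ˢ Set.Icc 0 (M : ℝ))) ≠ ⊤ := by
    rw [lintegral_tsum (fun q => (hmeas q).aemeasurable)]
    have hK : ENNReal.ofReal (M * (2 * M : ℝ) ^ (s + 1)) * ∑' q : ℕ × ℕ,
        (E ∩ {q | 1 ≤ q.1}).indicator
        (fun q => ENNReal.ofReal (((max q.1 q.2 : ℕ) : ℝ) ^ (-(s + 1)))) q ≠ ⊤ :=
      ENNReal.mul_ne_top ENNReal.ofReal_ne_top (series_finite E (s + 1) (by linarith) hs1)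
    refine ne_top_of_le_ne_top hK ?_
    rw [← ENNReal.tsum_mul_left]
    apply ENNReal.tsum_le_tsum
    intro q
    rw [lintegral_indicator_const (measurableSet_hitSet q),
      Measure.restrict_apply (measurableSet_hitSet q)]
    by_cases hq : q ∈ E ∩ {q | 1 ≤ q.1}
    · have hq1 : 1 ≤ q.1 := hq.2
      have hx : (1 : ℝ) ≤ q.1 := by exact_mod_cast hq1
      rw [hg, Set.indicator_of_mem hq, Set.indicator_of_mem hq]
      by_cases hy : q.2 ≤ 2 * M * q.1
      · refine (mul_le_mul_right (hitSet_measure q hq1 M) _).trans ?_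
        rw [← ENNReal.ofReal_mul (by positivity), ← ENNReal.ofReal_mul (by positivity)]
        apply ENNReal.ofReal_le_ofReal
        have hr : ((max q.1 q.2 : ℕ) : ℝ) ≤ 2 * M * q.1 := by
          have : max q.1 q.2 ≤ 2 * M * q.1 := max_le (by nlinarith) hy
          exact_mod_cast this
        have hr0 : (0 : ℝ) < ((max q.1 q.2 : ℕ) : ℝ) := by
          have : 0 < max q.1 q.2 := lt_of_lt_of_le hq1 (le_max_left _ _)
          exact_mod_cast this
        have h1 : (2 * M * q.1 : ℝ) ^ (-(s + 1)) ≤ ((max q.1 q.2 : ℕ) : ℝ) ^ (-(s + 1)) :=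
          Real.rpow_le_rpow_of_nonpos hr0 hr (by linarith)
        have h2 : (2 * M : ℝ) ^ (s + 1) * (2 * M * q.1 : ℝ) ^ (-(s + 1)) =
            (q.1 : ℝ) ^ (-s) * (q.1 : ℝ)⁻¹ := by
          rw [Real.mul_rpow (x := 2 * (M : ℝ)) (y := (q.1 : ℝ)) (by positivity) (by positivity),
            ← mul_assoc, ← Real.rpow_add (by positivity), add_neg_cancel, Real.rpow_zero, one_mul,
            neg_add, Real.rpow_add (by positivity), Real.rpow_neg_one]
        calc _ = M * ((q.1 : ℝ) ^ (-s) * (q.1 : ℝ)⁻¹) := by ring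
          _ = M * ((2 * M : ℝ) ^ (s + 1) * (2 * M * q.1 : ℝ) ^ (-(s + 1))) := by rw [h2]
          _ ≤ M * ((2 * M : ℝ) ^ (s + 1) * ((max q.1 q.2 : ℕ) : ℝ) ^ (-(s + 1))) := by gcongr
          _ = _ := by ring
      · have hemp : hitSet q ∩ (Set.Icc 0 (M : ℝ) ×ˢ Set.Icc 0 (M : ℝ)) = ∅ := by
          ext w
          simp only [Set.mem_empty_iff_false, iff_false]
          rintro ⟨h1, h2, h3⟩
          have h4 := (Int.floor_eq_iff.1 (Eq.symm h1)).1
          push_cast at h4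
          apply hy
          have : (q.2 : ℝ) ≤ 2 * M * q.1 := by
            have h5 : w.1 * q.1 ≤ M * q.1 := by gcongr; exact h2.2
            have h6 : (M : ℝ) ≤ M * q.1 := by nlinarith
            linarith [h3.2]
          exact_mod_cast this
        rw [hemp, measure_empty, mul_zero]
        exact zero_le
    · rw [hg, Set.indicator_of_notMem hq, zero_mul]
      exact zero_le
  filter_upwards [ae_lt_top (Measurable.tsum hmeas) hint] with w hw
  exact hw.ne

lemma ae_main (E : Set (ℕ × ℕ)) : ∀ᵐ w : ℝ × ℝ, 0 < w.1 → 0 < w.2 →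
    massDimN (sliceFloor E w.1 w.2) ≤ max 0 (massDim2 E - 1) := by
  have key : ∀ (n M : ℕ), ∀ᵐ w : ℝ × ℝ,
      w ∈ Set.Icc 0 ((M + 1 : ℕ) : ℝ) ×ˢ Set.Icc 0 ((M + 1 : ℕ) : ℝ) →
      ∑' q : ℕ × ℕ, (E ∩ {q | 1 ≤ q.1} ∩ {q | w ∈ hitSet q}).indicator
      (fun q => ENNReal.ofReal
        ((q.1 : ℝ) ^ (-(max 0 (massDim2 E - 1) + 1 / ((n : ℝ) + 1))))) q ≠ ⊤ := by
    intro n M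
    rw [← ae_restrict_iff' (measurableSet_Icc.prod measurableSet_Icc)]
    have hn : (0 : ℝ) < 1 / ((n : ℝ) + 1) := by positivity
    exact ae_box_s3 E _ (by linarith [le_max_left 0 (massDim2 E - 1)])
      (by linarith [le_max_right 0 (massDim2 E - 1)]) (M + 1) (by omega)
  have key2 := ae_all_iff.2 (fun n => ae_all_iff.2 (key n))
  filter_upwards [key2] with w hw hu hv
  apply le_of_forall_pos_lt_add
  intro ε hε
  obtain ⟨n, hn⟩ := exists_nat_one_div_lt (show (0 : ℝ) < ε / 2 by linarith)
  obtain ⟨M, hM⟩ := exists_nat_ge (max w.1 w.2)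
  have hmem : w ∈ Set.Icc 0 ((M + 1 : ℕ) : ℝ) ×ˢ Set.Icc 0 ((M + 1 : ℕ) : ℝ) := by
    have := le_max_left w.1 w.2
    have := le_max_right w.1 w.2
    push_cast
    exact ⟨⟨hu.le, by linarith⟩, hv.le, by linarith⟩
  have hn0 : (0 : ℝ) < 1 / ((n : ℝ) + 1) := by positivity
  have := slice_dim_le E _ (by linarith [le_max_left 0 (massDim2 E - 1)]) w.1 w.2 hu hv
    (hw n M hmem) (max 0 (massDim2 E - 1) + ε / 2) (by linarith)
  linarith

/-- Weak (asymptotic) slicing theorem in the real plane: for `E ⊆ ℕ²`, the set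
`U` of parameters `(u,v)` with `u,v > 0` for which
`D̄(E ∩ ⌊l_{u,v}⌋) ≤ max(0, D̄(E) - 1)` satisfies
`|U ∩ [0,M]²| / M² → 1` as `M → ∞` (Lebesgue measure). -/
theorem weak_real (E : Set (ℕ × ℕ)) :
    Filter.Tendsto (fun M : ℝ =>
      (MeasureTheory.volume
        ({uv : ℝ × ℝ | 0 < uv.1 ∧ 0 < uv.2 ∧
            massDimN (sliceFloor E uv.1 uv.2) ≤ max 0 (massDim2 E - 1)} ∩
          (Set.Icc 0 M ×ˢ Set.Icc 0 M))).toReal / M ^ 2)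
      Filter.atTop (nhds 1) := by
  apply tendsto_const_nhds.congr'
  filter_upwards [Filter.eventually_gt_atTop 0] with M hM
  have hvol : volume ({uv : ℝ × ℝ | 0 < uv.1 ∧ 0 < uv.2 ∧
            massDimN (sliceFloor E uv.1 uv.2) ≤ max 0 (massDim2 E - 1)} ∩
          (Set.Icc 0 M ×ˢ Set.Icc 0 M)) = ENNReal.ofReal (M ^ 2) := by
    have hIoc : volume ((Set.Ioc 0 M ×ˢ Set.Ioc 0 M) : Set (ℝ × ℝ)) = ENNReal.ofReal (M ^ 2) := by
      rw [Measure.volume_eq_prod, Measure.prod_prod, Real.volume_Ioc,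
        ← ENNReal.ofReal_mul (by linarith)]
      congr 1
      ring
    rw [← hIoc]
    apply measure_congr
    filter_upwards [ae_main E] with w hw
    apply propext
    constructor
    · rintro ⟨⟨h1, h2, -⟩, h3, h4⟩
      exact ⟨⟨h1, h3.2⟩, h2, h4.2⟩
    · rintro ⟨h1, h2⟩
      exact ⟨⟨h1.1, h2.1, hw h1.1 h2.1⟩, ⟨h1.1.le, h1.2⟩, h2.1.le, h2.2⟩
  rw [hvol, ENNReal.toReal_ofReal (by positivity), div_self (by positivity)]
end

section
/- Let p ≥ 3 be a prime and let E ⊆ 𝔽_p² be nonempty. Then there are at least p²·(1 − 1/log p) pairs (u,v) ∈ 𝔽_p² such that either E ∩ l_{u,v} is empty, or log|E ∩ l_{u,v}| / log p ≤ max(0, log|E|/log p − 1) + log(log p)/log p. -/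
open Set

/-- The line `l_{u,v} = {(x,y) ∈ 𝔽_p² : y = u·x + v}`. -/
def lineFF {p : ℕ} (u v : ZMod p) : Set (ZMod p × ZMod p) :=
  {q : ZMod p × ZMod p | q.2 = u * q.1 + v}

theorem sum_line_ncard (p : ℕ) [hp : Fact p.Prime] (E : Set (ZMod p × ZMod p)) :
    ∑ uv : ZMod p × ZMod p, (E ∩ lineFF uv.1 uv.2).ncard = E.ncard * p := by
  classical
  have h1 : ∀ uv : ZMod p × ZMod p, (E ∩ lineFF uv.1 uv.2).ncard =
      ∑ q ∈ E.toFinset, if q.2 = uv.1 * q.1 + uv.2 then 1 else 0 := by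
    intro uv
    rw [Set.ncard_eq_toFinset_card', ← Finset.sum_filter, ← Finset.card_eq_sum_ones]
    congr 1
    ext q
    rw [Set.mem_toFinset, Finset.mem_filter, Set.mem_toFinset]
    rfl
  simp_rw [h1]
  rw [Finset.sum_comm, Set.ncard_eq_toFinset_card']
  have h2 : ∀ q ∈ E.toFinset, (∑ uv : ZMod p × ZMod p,
      if q.2 = uv.1 * q.1 + uv.2 then 1 else 0) = p := by
    intro q _
    rw [Fintype.sum_prod_type]
    have h3 : ∀ u : ZMod p, (∑ v : ZMod p, if q.2 = u * q.1 + v then 1 else 0) = 1 := by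
      intro u
      have : ∀ v : ZMod p, (q.2 = u * q.1 + v) ↔ (q.2 - u * q.1 = v) := by
        intro v
        rw [sub_eq_iff_eq_add, add_comm]
      simp_rw [this]
      simp
    simp_rw [h3]
    simp [ZMod.card]
  rw [Finset.sum_congr rfl h2]
  simp

/-- Weak (asymptotic) slicing theorem in finite fields: for a prime `p ≥ 3`
and nonempty `E ⊆ 𝔽_p²`, at least `p²(1 - 1/log p)` pairs `(u,v) ∈ 𝔽_p²`
satisfy: either `E ∩ l_{u,v}` is empty, or
`log|E ∩ l_{u,v}| / log p ≤ max(0, log|E|/log p - 1) + log(log p)/log p`. -/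
theorem weak_finite (p : ℕ) [hp : Fact p.Prime] (hp3 : 3 ≤ p)
    (E : Set (ZMod p × ZMod p)) (hE : E.Nonempty) :
    (p : ℝ) ^ 2 * (1 - 1 / Real.log p) ≤
      (({uv : ZMod p × ZMod p |
          E ∩ lineFF uv.1 uv.2 = ∅ ∨
          Real.log ((E ∩ lineFF uv.1 uv.2).ncard) / Real.log p ≤
            max 0 (Real.log E.ncard / Real.log p - 1) +
              Real.log (Real.log p) / Real.log p}).ncard : ℝ) := by
  classical
  set G := {uv : ZMod p × ZMod p |
          E ∩ lineFF uv.1 uv.2 = ∅ ∨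
          Real.log ((E ∩ lineFF uv.1 uv.2).ncard) / Real.log p ≤
            max 0 (Real.log E.ncard / Real.log p - 1) +
              Real.log (Real.log p) / Real.log p} with hG
  have hp3' : (3 : ℝ) ≤ p := by exact_mod_cast hp3
  have hp0 : (0 : ℝ) < p := by linarith
  have hL : 0 < Real.log p := Real.log_pos (by linarith)
  have hE0 : (0 : ℝ) < E.ncard := by
    exact_mod_cast (Set.ncard_pos (Set.toFinite E)).2 hE
  have hbad : ∀ uv ∈ (Gᶜ).toFinset, (E.ncard : ℝ) / p * Real.log p ≤
      ((E ∩ lineFF uv.1 uv.2).ncard : ℝ) := by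
    intro uv huv
    rw [Set.mem_toFinset, hG, Set.mem_compl_iff, Set.mem_ofPred_eq, not_or, not_le] at huv
    obtain ⟨hne, hlt⟩ := huv
    have hpos : (0 : ℝ) < (E ∩ lineFF uv.1 uv.2).ncard := by
      exact_mod_cast (Set.ncard_pos (Set.toFinite _)).2 (Set.nonempty_iff_ne_empty.2 hne)
    have h1 : (Real.log E.ncard / Real.log p - 1) + Real.log (Real.log p) / Real.log p <
        Real.log ((E ∩ lineFF uv.1 uv.2).ncard) / Real.log p :=
      lt_of_le_of_lt (by gcongr; exact le_max_right _ _) hlt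
    rw [lt_div_iff₀ hL] at h1
    have h2 : (Real.log E.ncard / Real.log p - 1 + Real.log (Real.log p) / Real.log p)
        * Real.log p = Real.log E.ncard - Real.log p + Real.log (Real.log p) := by
      field_simp
    rw [h2, ← Real.log_div hE0.ne' hp0.ne', ← Real.log_mul (by positivity) hL.ne'] at h1
    exact ((Real.log_lt_log_iff (by positivity) hpos).1 h1).le
  have hsum : ((Gᶜ).ncard : ℝ) * ((E.ncard : ℝ) / p * Real.log p) ≤ E.ncard * p := by
    rw [Set.ncard_eq_toFinset_card', ← nsmul_eq_mul]
    refine (Finset.card_nsmul_le_sum _ _ _ hbad).trans ?_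
    refine (Finset.sum_le_univ_sum_of_nonneg (fun _ => Nat.cast_nonneg _)).trans ?_
    exact_mod_cast (sum_line_ncard p E).le
  have hcard : (G.ncard : ℝ) + (Gᶜ).ncard = (p : ℝ) ^ 2 := by
    have := Set.ncard_add_ncard_compl G
    rw [Nat.card_prod, Nat.card_zmod] at this
    rw [sq]
    exact_mod_cast this
  have hB : ((Gᶜ).ncard : ℝ) ≤ (p : ℝ) ^ 2 / Real.log p := by
    rw [le_div_iff₀ hL]
    have h3 : ((Gᶜ).ncard : ℝ) * Real.log p * E.ncard ≤ (p : ℝ) ^ 2 * E.ncard := by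
      calc ((Gᶜ).ncard : ℝ) * Real.log p * E.ncard
          = ((Gᶜ).ncard : ℝ) * ((E.ncard : ℝ) / p * Real.log p) * p := by field_simp
        _ ≤ E.ncard * p * p := by gcongr
        _ = (p : ℝ) ^ 2 * E.ncard := by ring
    exact le_of_mul_le_mul_right h3 hE0
  have h4 : (p : ℝ) ^ 2 * (1 - 1 / Real.log p) = (p : ℝ) ^ 2 - (p : ℝ) ^ 2 / Real.log p := by
    ring
  rw [h4]
  linarith
end

section
/- Let p ≥ 3 be a prime and let A, B ⊆ 𝔽_p be nonempty. Then there are at least p²·(1 − 1/log p) pairs (u,v) ∈ 𝔽_p² such that either A ∩ (uB + v) is empty, or log|A ∩ (uB + v)| / log p ≤ max(0, log|A|/log p + log|B|/log p − 1) + log(log p)/log p. -/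
open Set

/-- The set `A ∩ (u·B + v) = {a ∈ A : ∃ b ∈ B, a = u·b + v}` in `𝔽_p`. -/
def interFF {p : ℕ} (A B : Set (ZMod p)) (u v : ZMod p) : Set (ZMod p) :=
  {a ∈ A | ∃ b ∈ B, a = u * b + v}

open Classical in
theorem sum_interFF_le (p : ℕ) [Fact p.Prime] (A B : Set (ZMod p)) :
    ∑ uv : ZMod p × ZMod p, (interFF A B uv.1 uv.2).ncard ≤ p * (A.ncard * B.ncard) := by
  have h1 : ∀ uv : ZMod p × ZMod p, (interFF A B uv.1 uv.2).ncard ≤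
      ∑ ab ∈ A.toFinset ×ˢ B.toFinset, if ab.1 = uv.1 * ab.2 + uv.2 then 1 else 0 := by
    intro uv
    rw [← Finset.card_filter]
    have : interFF A B uv.1 uv.2 ⊆ (((A.toFinset ×ˢ B.toFinset).filter
        (fun ab => ab.1 = uv.1 * ab.2 + uv.2)).image Prod.fst : Finset (ZMod p)) := by
      rintro a ⟨ha, b, hb, hab⟩
      simp only [Finset.coe_image, Set.mem_image]
      exact ⟨(a, b), by simp [ha, hb, ← hab], rfl⟩
    refine (Set.ncard_le_ncard this (Set.toFinite _)).trans ?_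
    rw [Set.ncard_coe_finset]
    exact Finset.card_image_le
  refine (Finset.sum_le_sum fun uv _ => h1 uv).trans ?_
  rw [Finset.sum_comm]
  have h2 : ∀ ab ∈ A.toFinset ×ˢ B.toFinset,
      (∑ uv : ZMod p × ZMod p, if ab.1 = uv.1 * ab.2 + uv.2 then 1 else 0) ≤ p := by
    intro ab _
    rw [← Finset.card_filter]
    have : (Finset.univ : Finset (ZMod p)).card = p := by simp [ZMod.card]
    conv_rhs => rw [← this]
    refine Finset.card_le_card_of_injOn Prod.fst (fun _ _ => by simp) ?_
    rintro ⟨u, v⟩ h ⟨u', v'⟩ h' (rfl : u = u')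
    simp only [Finset.coe_filter, Finset.mem_univ, true_and, Set.mem_setOf_eq] at h h'
    rw [h] at h'
    rw [add_left_cancel h']
  refine (Finset.sum_le_card_nsmul _ _ _ h2).trans ?_
  rw [Finset.card_product, ← Set.ncard_eq_toFinset_card', ← Set.ncard_eq_toFinset_card',
    smul_eq_mul, mul_comm]

/-- Weak (asymptotic) slicing corollary in finite fields: for a prime `p ≥ 3`
and nonempty `A, B ⊆ 𝔽_p`, at least `p²(1 - 1/log p)` pairs `(u,v) ∈ 𝔽_p²`
satisfy: either `A ∩ (uB + v)` is empty, or
`log|A ∩ (uB+v)| / log p ≤ max(0, log|A|/log p + log|B|/log p - 1) + log(log p)/log p`. -/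
theorem weak_finite_grid (p : ℕ) [hp : Fact p.Prime] (hp3 : 3 ≤ p)
    (A B : Set (ZMod p)) (hA : A.Nonempty) (hB : B.Nonempty) :
    (p : ℝ) ^ 2 * (1 - 1 / Real.log p) ≤
      (({uv : ZMod p × ZMod p |
          interFF A B uv.1 uv.2 = ∅ ∨
          Real.log ((interFF A B uv.1 uv.2).ncard) / Real.log p ≤
            max 0 (Real.log A.ncard / Real.log p + Real.log B.ncard / Real.log p - 1) +
              Real.log (Real.log p) / Real.log p}).ncard : ℝ) := by
  classical
  have hp0 : (0 : ℝ) < p := by positivity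
  have hlog : 1 < Real.log p := by
    rw [Real.lt_log_iff_exp_lt hp0]
    have : (3 : ℝ) ≤ p := by exact_mod_cast hp3
    linarith [Real.exp_one_lt_d9]
  have hl0 : 0 < Real.log p := by linarith
  have hAp : (0 : ℝ) < A.ncard := by exact_mod_cast (Set.ncard_pos (Set.toFinite _)).2 hA
  have hBp : (0 : ℝ) < B.ncard := by exact_mod_cast (Set.ncard_pos (Set.toFinite _)).2 hB
  set G : Set (ZMod p × ZMod p) := {uv : ZMod p × ZMod p |
          interFF A B uv.1 uv.2 = ∅ ∨
          Real.log ((interFF A B uv.1 uv.2).ncard) / Real.log p ≤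
            max 0 (Real.log A.ncard / Real.log p + Real.log B.ncard / Real.log p - 1) +
              Real.log (Real.log p) / Real.log p} with hG
  have hcompl : (G.ncard : ℝ) + (Gᶜ).ncard = (p : ℝ) ^ 2 := by
    have := Set.ncard_add_ncard_compl G
    rw [Nat.card_prod, Nat.card_zmod] at this
    rw [sq]
    exact_mod_cast this
  have hbad : ∀ uv ∈ (Gᶜ).toFinset, (A.ncard : ℝ) * B.ncard / p * Real.log p ≤
      ((interFF A B uv.1 uv.2).ncard : ℝ) := by
    intro uv huv
    rw [Set.mem_toFinset, Set.mem_compl_iff, hG, Set.mem_setOf_eq, not_or, not_le] at huv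
    obtain ⟨hne, hlt⟩ := huv
    have hS : (0 : ℝ) < (interFF A B uv.1 uv.2).ncard := by
      exact_mod_cast (Set.ncard_pos (Set.toFinite _)).2 (Set.nonempty_iff_ne_empty.2 hne)
    have h1 := lt_of_le_of_lt (add_le_add_left (le_max_right 0 _) _) hlt
    rw [← Real.log_le_log_iff (by positivity) hS, Real.log_mul (by positivity) (by positivity),
      Real.log_div (by positivity) (by positivity), Real.log_mul (by positivity) (by positivity)]
    rw [lt_div_iff₀ hl0] at h1
    field_simp at h1
    linarith
  have hsum : ((Gᶜ).ncard : ℝ) * ((A.ncard : ℝ) * B.ncard / p * Real.log p) ≤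
      p * (A.ncard * B.ncard) := by
    have h1 := Finset.card_nsmul_le_sum _ _ _ hbad
    rw [← Set.ncard_eq_toFinset_card', nsmul_eq_mul] at h1
    refine h1.trans ?_
    refine (Finset.sum_le_univ_sum_of_nonneg (fun _ => by positivity)).trans ?_
    exact_mod_cast sum_interFF_le p A B
  have hfin : ((Gᶜ).ncard : ℝ) ≤ (p : ℝ) ^ 2 / Real.log p := by
    rw [le_div_iff₀ hl0]
    have hAB : (0 : ℝ) < A.ncard * B.ncard / p := by positivity
    refine le_of_mul_le_mul_right ?_ hAB
    calc _ = ((Gᶜ).ncard : ℝ) * ((A.ncard : ℝ) * B.ncard / p * Real.log p) := by ring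
      _ ≤ _ := hsum
      _ = _ := by field_simp
  have : (p : ℝ) ^ 2 * (1 - 1 / Real.log p) = (p : ℝ) ^ 2 - (p : ℝ) ^ 2 / Real.log p := by ring
  rw [this]
  linarith
end

section
/- Let 0 < s < t be real numbers, let S ⊆ [0,∞) be a set whose intersection with every bounded interval is finite, let n₁ ≥ 1 and n > 2·n₁ be real numbers, and suppose |S ∩ [0,n]| ≥ n^t and n^t > n^s/(2^s − 1) + |S ∩ [0, 2·n₁]|. Then there exists an integer k ≥ 1 with n/2^k > n₁ such that |S ∩ (n/2^k, n/2^{k−1}]| > (n/2^k)^s. -/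
open Set

/-- Dyadic-annulus pigeonhole lemma: let `0 < s < t`, let `S ⊆ [0,∞)` have
finite intersection with every bounded interval, let `n₁ ≥ 1` and `n > 2·n₁`,
and suppose `|S ∩ [0,n]| ≥ n^t` and `n^t > n^s/(2^s - 1) + |S ∩ [0, 2·n₁]|`.
Then there is an integer `k ≥ 1` with `n/2^k > n₁` and
`|S ∩ (n/2^k, n/2^{k-1}]| > (n/2^k)^s`. -/
theorem dyadic_annulus_pigeonhole (S : Set ℝ) (hS : S ⊆ Set.Ici 0)
    (hfin : ∀ a b : ℝ, (S ∩ Set.Icc a b).Finite)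
    (s t n n₁ : ℝ) (hs : 0 < s) (hst : s < t) (hn₁ : 1 ≤ n₁) (hn : 2 * n₁ < n)
    (h1 : n ^ t ≤ ((S ∩ Set.Icc 0 n).ncard : ℝ))
    (h2 : n ^ s / ((2 : ℝ) ^ s - 1) + ((S ∩ Set.Icc 0 (2 * n₁)).ncard : ℝ) < n ^ t) :
    ∃ k : ℕ, 1 ≤ k ∧ n₁ < n / 2 ^ k ∧
      (n / 2 ^ k) ^ s <
        ((S ∩ Set.Ioc (n / 2 ^ k) (n / 2 ^ (k - 1))).ncard : ℝ) := by
  by_contra hcon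
  push Not at hcon
  have hn0 : 0 < n := by linarith
  have h2s : (1 : ℝ) < (2 : ℝ) ^ s := Real.one_lt_rpow (by norm_num) hs
  have hd : 0 < (2 : ℝ) ^ s - 1 := by linarith
  have key : ∀ j : ℕ, n₁ < n / 2 ^ j →
      ((S ∩ Set.Icc 0 n).ncard : ℝ) + (n / 2 ^ j) ^ s / ((2 : ℝ) ^ s - 1) ≤
        n ^ s / ((2 : ℝ) ^ s - 1) + ((S ∩ Set.Icc 0 (n / 2 ^ j)).ncard : ℝ) := by
    intro j
    induction j with
    | zero => intro _; simp [add_comm]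
    | succ j ih =>
      intro hj
      have hx : n / 2 ^ j = 2 * (n / 2 ^ (j + 1)) := by
        rw [pow_succ]; field_simp
      have hc := hcon (j + 1) (by omega) hj
      simp only [Nat.add_sub_cancel] at hc
      have hi := ih (by rw [hx]; linarith)
      rw [hx] at hc hi
      generalize n / 2 ^ (j + 1) = y at *
      have hy : 0 ≤ y := by linarith
      rw [Real.mul_rpow (by norm_num) hy] at hi
      have e : (2 : ℝ) ^ s * y ^ s / ((2 : ℝ) ^ s - 1) = y ^ s / ((2 : ℝ) ^ s - 1) + y ^ s := by
        field_simp
        ring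
      have hsub : S ∩ Set.Icc 0 (2 * y) ⊆ (S ∩ Set.Icc 0 y) ∪ (S ∩ Set.Ioc y (2 * y)) := by
        rintro z ⟨hz, hz0, hz1⟩
        rcases le_or_gt z y with h | h
        · exact Or.inl ⟨hz, hz0, h⟩
        · exact Or.inr ⟨hz, h, hz1⟩
      have hf2 : (S ∩ Set.Ioc y (2 * y)).Finite :=
        (hfin y (2 * y)).subset (Set.inter_subset_inter_right _ Set.Ioc_subset_Icc_self)
      have hcard : (S ∩ Set.Icc 0 (2 * y)).ncard ≤
          (S ∩ Set.Icc 0 y).ncard + (S ∩ Set.Ioc y (2 * y)).ncard :=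
        (Set.ncard_le_ncard hsub ((hfin 0 y).union hf2)).trans (Set.ncard_union_le _ _)
      have hcard' : ((S ∩ Set.Icc 0 (2 * y)).ncard : ℝ) ≤
          (S ∩ Set.Icc 0 y).ncard + (S ∩ Set.Ioc y (2 * y)).ncard := by exact_mod_cast hcard
      linarith
  have hex : ∃ j : ℕ, n / 2 ^ j ≤ 2 * n₁ := by
    obtain ⟨j, hj⟩ := pow_unbounded_of_one_lt n (by norm_num : (1 : ℝ) < 2)
    refine ⟨j, ?_⟩
    rw [div_le_iff₀ (by positivity)]
    nlinarith
  classical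
  obtain ⟨j, hj, hmin⟩ : ∃ j : ℕ, n / 2 ^ j ≤ 2 * n₁ ∧ ∀ i < j, ¬ n / 2 ^ i ≤ 2 * n₁ :=
    ⟨Nat.find hex, Nat.find_spec hex, fun i hi => Nat.find_min hex hi⟩
  have hj1 : n₁ < n / 2 ^ j := by
    cases j with
    | zero => simp at hj; linarith
    | succ j =>
      have h := hmin j (by omega)
      have hx : n / 2 ^ j = 2 * (n / 2 ^ (j + 1)) := by
        rw [pow_succ]; field_simp
      rw [hx] at h
      linarith
  have hk := key j hj1
  have hpos : 0 ≤ (n / 2 ^ j) ^ s / ((2 : ℝ) ^ s - 1) := by positivity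
  have hle : ((S ∩ Set.Icc 0 (n / 2 ^ j)).ncard : ℝ) ≤ (S ∩ Set.Icc 0 (2 * n₁)).ncard := by
    exact_mod_cast Set.ncard_le_ncard
      (Set.inter_subset_inter_right _ (Set.Icc_subset_Icc_right hj)) (hfin _ _)
  linarith
end

section
/- Let E = {(m², n) ∈ ℕ² : m ≥ 1 and 0 ≤ n ≤ m}. Then for every n₀ ∈ ℕ, the horizontal slice {x ∈ ℕ : (x, n₀) ∈ E} = {m² : m ≥ max(1, n₀)} has mass dimension exactly 1/2. In particular, since D̄(E) = 1, every horizontal tube of width 1 meeting E has slice dimension 1/2 > max(0, D̄(E) − 1) = 0, so the roles of the slope parameter and the displacement parameter cannot be interchanged in the slicing theorem. -/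
open Filter Set

/-- The set `E = {(m², n) : m ≥ 1, 0 ≤ n ≤ m}`. -/
def Esq : Set (ℕ × ℕ) := {q : ℕ × ℕ | ∃ m : ℕ, 1 ≤ m ∧ q.1 = m ^ 2 ∧ q.2 ≤ m}


lemma aux_tendsto (f : ℕ → ℕ) (p : ℕ) (c C : ℝ) (hc : 0 < c) (hC : 0 < C)
    (h1 : ∀ᶠ N in atTop, c * (Nat.sqrt N : ℝ) ^ p ≤ f N)
    (h2 : ∀ᶠ N in atTop, (f N : ℝ) ≤ C * (Nat.sqrt N : ℝ) ^ p) :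
    Tendsto (fun N : ℕ => Real.log (f N) / Real.log N) atTop (nhds ((p : ℝ) / 2)) := by
  have hlog : Tendsto (fun N : ℕ => Real.log (N : ℝ)) atTop atTop :=
    Real.tendsto_log_atTop.comp tendsto_natCast_atTop_atTop
  have hK : ∀ K : ℝ, Tendsto (fun N : ℕ => (p : ℝ) / 2 + K / Real.log (N : ℝ)) atTop
      (nhds ((p : ℝ) / 2)) := by
    intro K
    simpa using (tendsto_const_nhds (x := (p : ℝ) / 2)).add (hlog.const_div_atTop K)
  refine tendsto_of_tendsto_of_tendsto_of_le_of_le' (hK (Real.log c - p * Real.log 2))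
    (hK (Real.log C)) ?_ ?_
  · filter_upwards [h1, eventually_ge_atTop 2] with N hN hN2
    have hs : 1 ≤ Nat.sqrt N := Nat.le_sqrt.2 (by omega)
    have hsR : (1 : ℝ) ≤ Nat.sqrt N := by exact_mod_cast hs
    have hL : 0 < Real.log (N : ℝ) := Real.log_pos (by exact_mod_cast hN2)
    have a : Real.log (c * (Nat.sqrt N : ℝ) ^ p) ≤ Real.log (f N) :=
      Real.log_le_log (by positivity) hN
    rw [Real.log_mul hc.ne' (by positivity), Real.log_pow] at a
    have b : (N : ℝ) ≤ (2 * (Nat.sqrt N : ℝ)) ^ 2 := by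
      have : N < (Nat.sqrt N + 1) * (Nat.sqrt N + 1) := Nat.lt_succ_sqrt N
      have : (N : ℝ) < ((Nat.sqrt N : ℝ) + 1) * (Nat.sqrt N + 1) := by exact_mod_cast this
      nlinarith
    have b2 := Real.log_le_log (by positivity) b
    rw [Real.log_pow, Real.log_mul (by norm_num) (by positivity)] at b2
    push_cast at b2
    have b3 : (p : ℝ) * Real.log N ≤ p * (2 * (Real.log 2 + Real.log (Nat.sqrt N))) :=
      mul_le_mul_of_nonneg_left b2 (by positivity)
    rw [le_div_iff₀ hL, add_mul, div_mul_cancel₀ _ hL.ne']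
    linarith
  · filter_upwards [h1, h2, eventually_ge_atTop 2] with N hN0 hN hN2
    have hs : 1 ≤ Nat.sqrt N := Nat.le_sqrt.2 (by omega)
    have hsR : (1 : ℝ) ≤ Nat.sqrt N := by exact_mod_cast hs
    have hL : 0 < Real.log (N : ℝ) := Real.log_pos (by exact_mod_cast hN2)
    have hf : (0 : ℝ) < f N := lt_of_lt_of_le (by positivity) hN0
    have a := Real.log_le_log hf hN
    rw [Real.log_mul hC.ne' (by positivity), Real.log_pow] at a
    have b : (Nat.sqrt N : ℝ) ^ 2 ≤ N := by exact_mod_cast Nat.sqrt_le' N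
    have b2 := Real.log_le_log (by positivity) b
    rw [Real.log_pow] at b2
    push_cast at b2
    have b3 : (p : ℝ) * (2 * Real.log (Nat.sqrt N)) ≤ p * Real.log N :=
      mul_le_mul_of_nonneg_left b2 (by positivity)
    rw [div_le_iff₀ hL, add_mul, div_mul_cancel₀ _ hL.ne']
    linarith

lemma sqrt_ev (k : ℕ) : ∀ᶠ N : ℕ in atTop, k ≤ Nat.sqrt N := by
  filter_upwards [eventually_ge_atTop (k * k)] with N hN
  exact Nat.le_sqrt.2 hN

lemma sq_inj : Function.Injective (fun m : ℕ => m ^ 2) :=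
  Nat.pow_left_injective (by norm_num)

lemma slice_eq (n₀ : ℕ) :
    {x : ℕ | (x, n₀) ∈ Esq} = {x : ℕ | ∃ m : ℕ, max 1 n₀ ≤ m ∧ x = m ^ 2} := by
  ext x
  simp only [Esq, Set.mem_ofPred_eq, max_le_iff]
  constructor
  · rintro ⟨m, h1, h2, h3⟩
    exact ⟨m, ⟨h1, h3⟩, h2⟩
  · rintro ⟨m, ⟨h1, h3⟩, h2⟩
    exact ⟨m, h1, h2, h3⟩

lemma slice_card (k N : ℕ) (hk : 1 ≤ k) :
    ({x : ℕ | ∃ m : ℕ, k ≤ m ∧ x = m ^ 2} ∩ Set.Icc 1 N).ncard = Nat.sqrt N + 1 - k := by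
  have : ({x : ℕ | ∃ m : ℕ, k ≤ m ∧ x = m ^ 2} ∩ Set.Icc 1 N)
      = (((Finset.Icc k (Nat.sqrt N)).image (fun m : ℕ => m ^ 2) : Finset ℕ) : Set ℕ) := by
    ext x
    simp only [Set.mem_inter_iff, Set.mem_ofPred_eq, Set.mem_Icc, Finset.coe_image, Set.mem_image,
      Finset.coe_Icc]
    constructor
    · rintro ⟨⟨m, h1, rfl⟩, h2, h3⟩
      exact ⟨m, ⟨h1, Nat.le_sqrt'.2 h3⟩, rfl⟩
    · rintro ⟨m, ⟨h1, h2⟩, rfl⟩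
      exact ⟨⟨m, h1, rfl⟩, Nat.one_le_pow _ _ (by omega), Nat.le_sqrt'.1 h2⟩
  rw [this, Set.ncard_coe_finset, Finset.card_image_of_injective _ sq_inj, Nat.card_Icc]

lemma slice_dim (n₀ : ℕ) : massDimN {x : ℕ | (x, n₀) ∈ Esq} = 1 / 2 := by
  rw [slice_eq]
  unfold massDimN
  refine Tendsto.limsup_eq ?_
  have := aux_tendsto (fun N => ({x : ℕ | ∃ m : ℕ, max 1 n₀ ≤ m ∧ x = m ^ 2} ∩
    Set.Icc 1 N).ncard) 1 (1 / 2) 1 (by norm_num) (by norm_num) ?_ ?_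
  · simpa using this
  · filter_upwards [sqrt_ev (2 * max 1 n₀)] with N hN
    rw [slice_card _ _ (le_max_left _ _)]
    have : Nat.sqrt N ≤ 2 * (Nat.sqrt N + 1 - max 1 n₀) := by omega
    have : (Nat.sqrt N : ℝ) ≤ 2 * ((Nat.sqrt N + 1 - max 1 n₀ : ℕ) : ℝ) := by exact_mod_cast this
    rw [pow_one]
    linarith
  · refine Eventually.of_forall fun N => ?_
    rw [slice_card _ _ (le_max_left _ _), pow_one, one_mul]
    have : Nat.sqrt N + 1 - max 1 n₀ ≤ Nat.sqrt N := by omega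
    exact_mod_cast this

lemma E_upper (N : ℕ) : (Esq ∩ (Set.Icc 0 N ×ˢ Set.Icc 0 N)).ncard
    ≤ Nat.sqrt N * (Nat.sqrt N + 1) := by
  have : Esq ∩ (Set.Icc 0 N ×ˢ Set.Icc 0 N) ⊆
      ((((Finset.Icc 1 (Nat.sqrt N)).image (fun m : ℕ => m ^ 2)) ×ˢ
        Finset.range (Nat.sqrt N + 1) : Finset (ℕ × ℕ)) : Set (ℕ × ℕ)) := by
    rintro ⟨x, n⟩ ⟨⟨m, h1, h2, h3⟩, ⟨_, h4⟩, _⟩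
    simp only at h2 h3 h4
    subst h2
    have h5 : m ≤ Nat.sqrt N := Nat.le_sqrt'.2 h4
    rw [Finset.mem_coe, Finset.mem_product, Finset.mem_image, Finset.mem_range]
    exact ⟨⟨m, Finset.mem_Icc.2 ⟨h1, h5⟩, rfl⟩, by simp only; omega⟩
  refine (Set.ncard_le_ncard this (Finset.finite_toSet _)).trans ?_
  rw [Set.ncard_coe_finset, Finset.card_product, Finset.card_image_of_injective _ sq_inj,
    Nat.card_Icc, Finset.card_range]
  simp

lemma E_lower (N k : ℕ) : (Nat.sqrt N - k) * (k + 1) ≤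
    (Esq ∩ (Set.Icc 0 N ×ˢ Set.Icc 0 N)).ncard := by
  have : ((((Finset.Icc (k + 1) (Nat.sqrt N)).image (fun m : ℕ => m ^ 2)) ×ˢ
        Finset.range (k + 1) : Finset (ℕ × ℕ)) : Set (ℕ × ℕ)) ⊆
      Esq ∩ (Set.Icc 0 N ×ˢ Set.Icc 0 N) := by
    rintro ⟨x, n⟩ h
    rw [Finset.mem_coe, Finset.mem_product, Finset.mem_image, Finset.mem_range] at h
    obtain ⟨⟨m, hm, h1⟩, h2⟩ := h
    simp only at h1 h2
    subst h1
    rw [Finset.mem_Icc] at hm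
    have h6 : Nat.sqrt N ≤ N := Nat.sqrt_le_self N
    refine ⟨⟨m, by omega, rfl, by simp only; omega⟩, ⟨Nat.zero_le _, Nat.le_sqrt'.1 hm.2⟩,
      Nat.zero_le _, by simp only; omega⟩
  have h := Set.ncard_le_ncard this
    (((Set.finite_Icc 0 N).prod (Set.finite_Icc 0 N)).subset Set.inter_subset_right)
  rw [Set.ncard_coe_finset, Finset.card_product, Finset.card_image_of_injective _ sq_inj,
    Nat.card_Icc, Finset.card_range] at h
  simpa using h

lemma E_dim : massDim2 Esq = 1 := by
  unfold massDim2
  refine Tendsto.limsup_eq ?_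
  have := aux_tendsto (fun N => (Esq ∩ (Set.Icc 0 N ×ˢ Set.Icc 0 N)).ncard) 2 (1 / 4) 2
    (by norm_num) (by norm_num) ?_ ?_
  · simpa using this
  · refine Eventually.of_forall fun N => ?_
    have h := E_lower N (Nat.sqrt N / 2)
    have h1 : Nat.sqrt N ≤ 2 * (Nat.sqrt N - Nat.sqrt N / 2) := by omega
    have h2 : Nat.sqrt N ≤ 2 * (Nat.sqrt N / 2 + 1) := by omega
    have h3 := Nat.mul_le_mul h1 h2
    have h4 : Nat.sqrt N ^ 2 ≤ 4 * (Esq ∩ (Set.Icc 0 N ×ˢ Set.Icc 0 N)).ncard := by nlinarith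
    have h5 : (Nat.sqrt N : ℝ) ^ 2 ≤ 4 * ((Esq ∩ (Set.Icc 0 N ×ˢ Set.Icc 0 N)).ncard : ℝ) := by
      exact_mod_cast h4
    linarith
  · filter_upwards [sqrt_ev 1] with N hN
    have h := E_upper N
    have h4 : (Esq ∩ (Set.Icc 0 N ×ˢ Set.Icc 0 N)).ncard ≤ 2 * Nat.sqrt N ^ 2 := by nlinarith
    exact_mod_cast h4

/-- Every horizontal slice `{x : (x, n₀) ∈ E}` of `E = {(m², n) : m ≥ 1, 0 ≤ n ≤ m}`
equals `{m² : m ≥ max(1, n₀)}` and has mass dimension exactly `1/2`.  In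
particular, since `D̄(E) = 1`, every horizontal tube of width 1 meeting `E` has
slice dimension `1/2 > max(0, D̄(E) − 1) = 0`, so the slope and displacement
parameters cannot be interchanged in the slicing theorem. -/
theorem horizontal_slices_of_Esq :
    (∀ n₀ : ℕ,
      {x : ℕ | (x, n₀) ∈ Esq} = {x : ℕ | ∃ m : ℕ, max 1 n₀ ≤ m ∧ x = m ^ 2} ∧
      massDimN {x : ℕ | (x, n₀) ∈ Esq} = 1 / 2) ∧
    massDim2 Esq = 1 ∧
    (1 / 2 : ℝ) > max 0 (massDim2 Esq - 1) := by
  refine ⟨fun n₀ => ⟨slice_eq n₀, slice_dim n₀⟩, E_dim, ?_⟩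
  rw [E_dim]
  norm_num
end

section
/- There exists a 1-separated set E ⊆ ℝ² with mass dimension D̄(E) = 1 and a nonempty open interval I ⊆ (0,∞) such that for every slope s ∈ I, the intersection E ∩ T_s is infinite and has mass dimension D̄(E ∩ T_s) = 0, where T_s is the width-1 tube of slope s whose lower boundary line passes through the origin. -/
open Filter Set

/-- The width-1 tube of slope `s` whose lower boundary line passes through the
origin: `T_s = {(x,y) : s·x < y ≤ s·x + √(1+s²)}`. -/
def tubeSlope (s : ℝ) : Set (ℝ × ℝ) :=
  {q : ℝ × ℝ | s * q.1 < q.2 ∧ q.2 ≤ s * q.1 + Real.sqrt (1 + s ^ 2)}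

/-- The points of the example: `n ↦ (2^⌊log₂ n⌋, n)`. -/
noncomputable def dyadicPt (n : ℕ) : ℝ × ℝ := ((2 : ℝ) ^ (Nat.log 2 n), (n : ℝ))

lemma dyadicPt_injective : Function.Injective dyadicPt := by
  intro m n h
  have := congrArg Prod.snd h
  simpa [dyadicPt] using this

lemma dyadicPt_sep : OneSeparated (Set.range dyadicPt) := by
  rintro _ ⟨m, rfl⟩ _ ⟨n, rfl⟩ hne
  have hmn : (m : ℤ) ≠ n := by
    intro h
    apply hne
    rw [Int.ofNat_inj.mp h]
  apply Real.le_sqrt_of_sq_le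
  have h1 : (1 : ℤ) ≤ ((m : ℤ) - n) ^ 2 := by
    have : 0 < ((m : ℤ) - n) ^ 2 := by
      have := sub_ne_zero.mpr hmn
      positivity
    linarith
  have h2 : (1 : ℝ) ≤ ((m : ℝ) - n) ^ 2 := by exact_mod_cast h1
  simp only [dyadicPt]
  nlinarith [sq_nonneg ((2 : ℝ) ^ (Nat.log 2 m) - 2 ^ (Nat.log 2 n))]

lemma dyadicPt_box (l : ℝ) (hl : 1 ≤ l) :
    Set.range dyadicPt ∩ (Set.Icc (-l) l ×ˢ Set.Icc (-l) l)
      = dyadicPt '' (Set.Iic ⌊l⌋₊) := by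
  have hl0 : 0 ≤ l := by linarith
  ext p
  constructor
  · rintro ⟨⟨n, rfl⟩, -, h⟩
    exact ⟨n, Nat.le_floor h.2, rfl⟩
  · rintro ⟨n, hn, rfl⟩
    have hn' : (n : ℝ) ≤ l := (Nat.le_floor_iff hl0).mp hn
    have h0 : (0 : ℝ) ≤ n := Nat.cast_nonneg n
    have hp : (0 : ℝ) < (2 : ℝ) ^ (Nat.log 2 n) := by positivity
    have h2 : (2 : ℝ) ^ (Nat.log 2 n) ≤ l := by
      rcases Nat.eq_zero_or_pos n with rfl | hpos
      · simpa using hl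
      · have : 2 ^ (Nat.log 2 n) ≤ n := Nat.pow_log_le_self 2 hpos.ne'
        have : (2 : ℝ) ^ (Nat.log 2 n) ≤ n := by exact_mod_cast this
        linarith
    refine ⟨⟨n, rfl⟩, ⟨?_, h2⟩, ⟨?_, hn'⟩⟩ <;> simp only [dyadicPt] <;> linarith

lemma tendsto_log_two_mul :
    Tendsto (fun l : ℝ => Real.log (2 * l)) atTop atTop :=
  Real.tendsto_log_atTop.comp (tendsto_id.const_mul_atTop (by norm_num))

lemma dyadicPt_dim : massDimR (Set.range dyadicPt) = 1 := by
  apply Tendsto.limsup_eq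
  have hlow : Tendsto (fun l : ℝ => 1 - Real.log 2 / Real.log (2 * l)) atTop (nhds 1) := by
    have := (tendsto_log_two_mul.const_div_atTop (Real.log 2)).const_sub 1
    simpa using this
  refine tendsto_of_tendsto_of_tendsto_of_le_of_le' hlow tendsto_const_nhds ?_ ?_
  all_goals
    filter_upwards [eventually_ge_atTop (1 : ℝ)] with l hl
    have hx : 0 < Real.log (2 * l) := Real.log_pos (by linarith)
    rw [dyadicPt_box l hl, Set.ncard_image_of_injective _ dyadicPt_injective]
    have hc : (Set.Iic ⌊l⌋₊).ncard = ⌊l⌋₊ + 1 := by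
      rw [Set.ncard_eq_toFinset_card']; simp
    rw [hc]
    push_cast
  · have h := Nat.lt_floor_add_one l
    have h2 : Real.log l ≤ Real.log ((⌊l⌋₊ : ℝ) + 1) :=
      Real.log_le_log (by linarith) h.le
    have h3 : Real.log (2 * l) = Real.log 2 + Real.log l :=
      Real.log_mul (by norm_num) (by linarith)
    rw [le_div_iff₀ hx, sub_mul, div_mul_cancel₀ _ hx.ne']
    linarith
  · rw [div_le_one hx]
    have h := Nat.floor_le (by linarith : 0 ≤ l)
    exact Real.log_le_log (by positivity) (by linarith)

lemma sqrt_slope_bounds {s : ℝ} (h1 : 1 < s) (h2 : s < 3 / 2) :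
    1 ≤ Real.sqrt (1 + s ^ 2) ∧ Real.sqrt (1 + s ^ 2) < 2 := by
  constructor
  · exact Real.le_sqrt_of_sq_le (by nlinarith)
  · rw [Real.sqrt_lt' (by norm_num)]; nlinarith

lemma dyadicPt_slice_infinite {s : ℝ} (h1 : 1 < s) (h2 : s < 3 / 2) :
    (Set.range dyadicPt ∩ tubeSlope s).Infinite := by
  have hlog : ∀ k : ℕ, Nat.log 2 (⌊s * 2 ^ (k + 2)⌋₊ + 1) = k + 2 := by
    intro k
    have hR : (4 : ℝ) ≤ 2 ^ (k + 2) := by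
      have : (1 : ℝ) ≤ 2 ^ k := one_le_pow₀ (by norm_num)
      rw [pow_add]; linarith
    have hpos : 0 ≤ s * 2 ^ (k + 2) := by positivity
    have ha := Nat.lt_floor_add_one (s * 2 ^ (k + 2))
    have hb := Nat.floor_le hpos
    apply Nat.log_eq_of_pow_le_of_lt_pow
    · have : (2 : ℝ) ^ (k + 2) ≤ (⌊s * 2 ^ (k + 2)⌋₊ : ℝ) + 1 := by nlinarith
      exact_mod_cast this
    · have : (⌊s * 2 ^ (k + 2)⌋₊ : ℝ) + 1 < (2 : ℝ) ^ (k + 2 + 1) := by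
        rw [pow_succ _ (k + 2)]; nlinarith
      exact_mod_cast this
  apply Set.infinite_of_injective_forall_mem
    (f := fun k : ℕ => dyadicPt (⌊s * 2 ^ (k + 2)⌋₊ + 1))
  · intro k k' h
    have h' := congrArg (Nat.log 2) (dyadicPt_injective h)
    rw [hlog, hlog] at h'
    omega
  · intro k
    refine ⟨⟨_, rfl⟩, ?_⟩
    have hpos : 0 ≤ s * 2 ^ (k + 2) := by positivity
    have ha := Nat.lt_floor_add_one (s * 2 ^ (k + 2))
    have hb := Nat.floor_le hpos
    have hs := (sqrt_slope_bounds h1 h2).1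
    simp only [tubeSlope, dyadicPt, Set.mem_setOf_eq, hlog]
    push_cast
    constructor <;> linarith

lemma dyadicPt_slice_card {s : ℝ} (h1 : 1 < s) (h2 : s < 3 / 2) (l : ℝ) (hl : 1 ≤ l) :
    (((Set.range dyadicPt ∩ tubeSlope s) ∩ (Set.Icc (-l) l ×ˢ Set.Icc (-l) l)).ncard : ℝ)
      ≤ 4 * Real.log (2 * l) := by
  set K := Nat.log 2 ⌊l⌋₊ with hK
  set F : Finset (ℕ × ℕ) := Finset.range (K + 1) ×ˢ Finset.range 2 with hF
  set g : ℕ × ℕ → ℝ × ℝ := fun p => dyadicPt (⌊s * 2 ^ p.1⌋₊ + 1 + p.2) with hg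
  have hsub : ((Set.range dyadicPt ∩ tubeSlope s) ∩ (Set.Icc (-l) l ×ˢ Set.Icc (-l) l))
      ⊆ g '' (F : Set (ℕ × ℕ)) := by
    rintro _ ⟨⟨⟨n, rfl⟩, ht⟩, -, hb⟩
    have hn : n ≤ ⌊l⌋₊ := Nat.le_floor hb.2
    simp only [tubeSlope, dyadicPt, Set.mem_setOf_eq] at ht
    have hs := (sqrt_slope_bounds h1 h2).2
    have hpos : 0 ≤ s * 2 ^ (Nat.log 2 n) := by positivity
    have ha := Nat.lt_floor_add_one (s * 2 ^ (Nat.log 2 n))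
    have hlt : ⌊s * 2 ^ (Nat.log 2 n)⌋₊ < n := (Nat.floor_lt hpos).mpr ht.1
    have hlt2 : n < ⌊s * 2 ^ (Nat.log 2 n)⌋₊ + 3 := by
      have : (n : ℝ) < (⌊s * 2 ^ (Nat.log 2 n)⌋₊ : ℝ) + 3 := by linarith [ht.2]
      exact_mod_cast this
    refine ⟨(Nat.log 2 n, n - ⌊s * 2 ^ (Nat.log 2 n)⌋₊ - 1), ?_, ?_⟩
    · have : Nat.log 2 n ≤ K := Nat.log_mono_right hn
      simp only [hF, Finset.coe_product, Set.mem_prod, Finset.mem_coe, Finset.mem_range]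
      omega
    · simp only [hg]
      congr 1
      omega
  have hcard : ((Set.range dyadicPt ∩ tubeSlope s) ∩
      (Set.Icc (-l) l ×ˢ Set.Icc (-l) l)).ncard ≤ (K + 1) * 2 := by
    calc _ ≤ (g '' (F : Set (ℕ × ℕ))).ncard :=
          Set.ncard_le_ncard hsub ((Finset.finite_toSet F).image g)
      _ ≤ (F : Set (ℕ × ℕ)).ncard := Set.ncard_image_le (Finset.finite_toSet F)
      _ = (K + 1) * 2 := by rw [Set.ncard_coe_finset, hF]; simp
  have hKl : (2 : ℝ) ^ (K + 1) ≤ 2 * l := by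
    have hfl : ⌊l⌋₊ ≠ 0 := by
      have : 1 ≤ ⌊l⌋₊ := Nat.le_floor (by simpa using hl)
      omega
    have h : 2 ^ K ≤ ⌊l⌋₊ := Nat.pow_log_le_self 2 hfl
    have h' : (2 : ℝ) ^ K ≤ ⌊l⌋₊ := by exact_mod_cast h
    have := Nat.floor_le (by linarith : 0 ≤ l)
    rw [pow_succ]; linarith
  have hlog : ((K : ℝ) + 1) * Real.log 2 ≤ Real.log (2 * l) := by
    have := Real.log_le_log (by positivity) hKl
    rw [Real.log_pow] at this
    exact_mod_cast this
  have h2l : (1 / 2 : ℝ) ≤ Real.log 2 := by linarith [Real.log_two_gt_d9]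
  have hc : (((Set.range dyadicPt ∩ tubeSlope s) ∩
      (Set.Icc (-l) l ×ˢ Set.Icc (-l) l)).ncard : ℝ) ≤ ((K : ℝ) + 1) * 2 := by
    exact_mod_cast hcard
  have hK0 : (0 : ℝ) ≤ K := Nat.cast_nonneg K
  nlinarith

lemma dyadicPt_slice_dim {s : ℝ} (h1 : 1 < s) (h2 : s < 3 / 2) :
    massDimR (Set.range dyadicPt ∩ tubeSlope s) = 0 := by
  apply Tendsto.limsup_eq
  have hup : Tendsto (fun l : ℝ => (Real.log 4 + Real.log (Real.log (2 * l))) / Real.log (2 * l))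
      atTop (nhds 0) := by
    have ha := tendsto_log_two_mul.const_div_atTop (Real.log 4)
    have hb : Tendsto (fun x : ℝ => Real.log x / x) atTop (nhds 0) :=
      Real.isLittleO_log_id_atTop.tendsto_div_nhds_zero
    have hc := ha.add (hb.comp tendsto_log_two_mul)
    simpa [add_div, Function.comp_def] using hc
  refine tendsto_of_tendsto_of_tendsto_of_le_of_le' tendsto_const_nhds hup ?_ ?_
  · filter_upwards [eventually_ge_atTop (1 : ℝ)] with l hl
    exact div_nonneg (Real.log_natCast_nonneg _) (Real.log_nonneg (by linarith))
  · filter_upwards [eventually_ge_atTop (1 : ℝ), tendsto_log_two_mul.eventually_ge_atTop 1]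
      with l hl hx
    have hcard := dyadicPt_slice_card h1 h2 l hl
    have hx0 : 0 < Real.log (2 * l) := by linarith
    apply div_le_div_of_nonneg_right _ hx0.le
    rw [← Real.log_mul (by norm_num) hx0.ne']
    rcases Nat.eq_zero_or_pos ((Set.range dyadicPt ∩ tubeSlope s) ∩
      (Set.Icc (-l) l ×ˢ Set.Icc (-l) l)).ncard with h0 | hpos
    · rw [h0]
      simp only [Nat.cast_zero, Real.log_zero]
      exact Real.log_nonneg (by linarith)
    · exact Real.log_le_log (by exact_mod_cast hpos) hcard

/-- There exists a 1-separated set `E ⊆ ℝ²` with `D̄(E) = 1` and a nonempty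
open interval `I ⊆ (0,∞)` such that for every `s ∈ I`, the intersection
`E ∩ T_s` is infinite and `D̄(E ∩ T_s) = 0`. -/
theorem exists_dim_one_all_slices_dim_zero :
    ∃ E : Set (ℝ × ℝ), OneSeparated E ∧ massDimR E = 1 ∧
      ∃ a b : ℝ, 0 < a ∧ a < b ∧
        ∀ s ∈ Set.Ioo a b,
          (E ∩ tubeSlope s).Infinite ∧ massDimR (E ∩ tubeSlope s) = 0 := by
  refine ⟨Set.range dyadicPt, dyadicPt_sep, dyadicPt_dim, 1, 3 / 2, by norm_num, by norm_num, ?_⟩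
  rintro s ⟨h1, h2⟩
  exact ⟨dyadicPt_slice_infinite h1 h2, dyadicPt_slice_dim h1 h2⟩
end

section
/- There exists a 1-separated set E ⊆ ℝ² with mass dimension D̄(E) = 3/2 and a nonempty open interval I ⊆ (0,∞) such that for every slope s ∈ I, the intersection E ∩ T_s has mass dimension D̄(E ∩ T_s) = 1/2, where T_s is the width-1 tube of slope s whose lower boundary line passes through the origin. Hence the bound D̄(E ∩ t) ≤ max(0, D̄(E) − 1) in the slicing theorem is attained and cannot be improved. -/
open Filter Set

lemma massDimR_eq_of_bounds (E : Set (ℝ × ℝ)) (α c C : ℝ) (hc : 0 < c) (hC : 0 < C)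
    (h : ∀ l : ℝ, 4 ≤ l →
      c * l ^ α ≤ ((E ∩ (Set.Icc (-l) l ×ˢ Set.Icc (-l) l)).ncard : ℝ) ∧
      ((E ∩ (Set.Icc (-l) l ×ˢ Set.Icc (-l) l)).ncard : ℝ) ≤ C * l ^ α) :
    massDimR E = α := by
  have key : ∀ d : ℝ, Tendsto (fun l : ℝ => (Real.log d + α * Real.log l) / Real.log (2 * l))
      atTop (nhds α) := by
    intro d
    have h1 : Tendsto (fun l : ℝ => Real.log (2 * l)) atTop atTop :=
      Real.tendsto_log_atTop.comp (tendsto_id.const_mul_atTop (by norm_num : (0 : ℝ) < 2))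
    have h2 : Tendsto (fun l : ℝ => (Real.log d - α * Real.log 2) / Real.log (2 * l) + α)
        atTop (nhds (0 + α)) := (h1.const_div_atTop _).add_const α
    rw [zero_add] at h2
    refine h2.congr' ?_
    filter_upwards [eventually_ge_atTop 4] with l hl
    have h3 : 0 < Real.log (2 * l) := Real.log_pos (by linarith)
    have h4 : Real.log (2 * l) = Real.log 2 + Real.log l :=
      Real.log_mul (by norm_num) (by linarith)
    rw [div_add' _ _ _ h3.ne', h4]
    ring_nf
  refine Tendsto.limsup_eq (tendsto_of_tendsto_of_tendsto_of_le_of_le' (key c) (key C) ?_ ?_)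
  · filter_upwards [eventually_ge_atTop 4] with l hl
    have h3 : 0 < Real.log (2 * l) := Real.log_pos (by linarith)
    have hl0 : 0 < l := by linarith
    have hp : 0 < l ^ α := Real.rpow_pos_of_pos hl0 α
    rw [← Real.log_rpow hl0, ← Real.log_mul hc.ne' hp.ne']
    have := (h l hl).1
    gcongr
  · filter_upwards [eventually_ge_atTop 4] with l hl
    have h3 : 0 < Real.log (2 * l) := Real.log_pos (by linarith)
    have hl0 : 0 < l := by linarith
    have hp : 0 < l ^ α := Real.rpow_pos_of_pos hl0 α
    rw [← Real.log_rpow hl0, ← Real.log_mul hC.ne' hp.ne']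
    have h5 := (h l hl).1
    have h6 : 0 < c * l ^ α := by positivity
    have := (h l hl).2
    have h7 := h6.trans_le h5
    gcongr

/-- The lattice point in column `k ^ 2` and row `j`. -/
def sqPt (p : ℕ × ℤ) : ℝ × ℝ := ((p.1 : ℝ) ^ 2, (p.2 : ℝ))

lemma sqPt_injective : Function.Injective sqPt := by
  rintro ⟨k, j⟩ ⟨k', j'⟩ h
  simp only [sqPt, Prod.mk.injEq] at h
  obtain ⟨h1, h2⟩ := h
  have h3 : k ^ 2 = k' ^ 2 := by exact_mod_cast h1
  have h4 : k = k' := Nat.pow_left_injective (n := 2) (by norm_num) h3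
  have h5 : j = j' := by exact_mod_cast h2
  rw [h4, h5]

lemma sqPt_separated : OneSeparated (range sqPt) := by
  rintro _ ⟨⟨k, j⟩, rfl⟩ _ ⟨⟨k', j'⟩, rfl⟩ hne
  rw [Real.one_le_sqrt]
  simp only [sqPt] at hne ⊢
  have h : (0 : ℤ) < ((k : ℤ) ^ 2 - (k' : ℤ) ^ 2) ^ 2 + (j - j') ^ 2 := by
    by_contra hcon
    have h1 : ((k : ℤ) ^ 2 - (k' : ℤ) ^ 2) ^ 2 = 0 := by
      nlinarith [sq_nonneg ((k : ℤ) ^ 2 - (k' : ℤ) ^ 2), sq_nonneg (j - j')]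
    have h2 : (j - j') ^ 2 = 0 := by
      nlinarith [sq_nonneg ((k : ℤ) ^ 2 - (k' : ℤ) ^ 2), sq_nonneg (j - j')]
    have h1' := pow_eq_zero_iff (two_ne_zero) |>.1 h1
    have h2' := pow_eq_zero_iff (two_ne_zero) |>.1 h2
    apply hne
    have h3 : (k : ℤ) ^ 2 = (k' : ℤ) ^ 2 := by linarith
    have h4 : j = j' := by linarith
    have h5 : (k : ℝ) ^ 2 = (k' : ℝ) ^ 2 := by exact_mod_cast h3
    rw [h4, h5]
  have h' : (1 : ℤ) ≤ ((k : ℤ) ^ 2 - (k' : ℤ) ^ 2) ^ 2 + (j - j') ^ 2 := h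
  exact_mod_cast h'

lemma nat_le_floor_sqrt {k : ℕ} {l : ℝ} (h : (k : ℝ) ^ 2 ≤ l) :
    k < ⌊Real.sqrt l⌋₊ + 1 :=
  Nat.lt_succ_of_le (Nat.le_floor (Real.le_sqrt_of_sq_le h))

lemma massDimR_range_sqPt : massDimR (range sqPt) = 3 / 2 := by
  refine massDimR_eq_of_bounds _ _ 1 6 one_pos (by norm_num) ?_
  intro l hl
  have hl0 : 0 < l := by linarith
  have hs : Real.sqrt l ^ 2 = l := Real.sq_sqrt hl0.le
  have hs0 : 0 ≤ Real.sqrt l := Real.sqrt_nonneg l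
  have hs1 : 1 ≤ Real.sqrt l := Real.one_le_sqrt.2 (by linarith)
  have hpow : l ^ (3 / 2 : ℝ) = Real.sqrt l * l := by
    rw [show (3 / 2 : ℝ) = 1 / 2 + 1 by norm_num, Real.rpow_add hl0, Real.rpow_one,
      Real.sqrt_eq_rpow]
  have hset : range sqPt ∩ (Set.Icc (-l) l ×ˢ Set.Icc (-l) l) =
      sqPt '' (((Finset.range (⌊Real.sqrt l⌋₊ + 1)) ×ˢ (Finset.Icc (-⌊l⌋) ⌊l⌋) :
        Finset (ℕ × ℤ)) : Set (ℕ × ℤ)) := by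
    ext q
    constructor
    · rintro ⟨⟨⟨k, j⟩, rfl⟩, ⟨⟨_, h1⟩, ⟨h2, h3⟩⟩⟩
      refine ⟨(k, j), ?_, rfl⟩
      simp only [sqPt] at h1 h2 h3
      simp only [Finset.coe_product, Set.mem_prod, Finset.mem_coe, Finset.mem_range,
        Finset.mem_Icc]
      refine ⟨nat_le_floor_sqrt h1, ?_, Int.le_floor.2 h3⟩
      have : -j ≤ ⌊l⌋ := Int.le_floor.2 (by push_cast; linarith)
      linarith
    · rintro ⟨⟨k, j⟩, h, rfl⟩
      simp only [Finset.coe_product, Set.mem_prod, Finset.mem_coe, Finset.mem_range,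
        Finset.mem_Icc] at h
      obtain ⟨h1, h2, h3⟩ := h
      have hk : (k : ℝ) ≤ Real.sqrt l := (Nat.le_floor_iff hs0).1 (Nat.le_of_lt_succ h1)
      have hk0 : (0 : ℝ) ≤ k := Nat.cast_nonneg k
      have h3' : (j : ℝ) ≤ l := Int.le_floor.1 h3
      have h2' : ((-j : ℤ) : ℝ) ≤ l := Int.le_floor.1 (by linarith)
      push_cast at h2'
      refine ⟨⟨_, rfl⟩, ⟨?_, ?_⟩, ⟨?_, h3'⟩⟩ <;> simp only [sqPt] <;> nlinarith
  have hfl0 : 0 ≤ ⌊l⌋ := Int.floor_nonneg.2 hl0.le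
  have hcard : ((range sqPt ∩ (Set.Icc (-l) l ×ˢ Set.Icc (-l) l)).ncard : ℝ) =
      ((⌊Real.sqrt l⌋₊ : ℝ) + 1) * (2 * (⌊l⌋ : ℝ) + 1) := by
    rw [hset, Set.ncard_image_of_injective _ sqPt_injective, Set.ncard_coe_finset,
      Finset.card_product, Finset.card_range, Int.card_Icc]
    have : (((⌊l⌋ + 1 - -⌊l⌋).toNat : ℤ) : ℝ) = 2 * (⌊l⌋ : ℝ) + 1 := by
      rw [Int.toNat_of_nonneg (by linarith)]
      push_cast
      ring
    rw [Int.cast_natCast] at this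
    push_cast
    rw [this]
  rw [hcard, hpow]
  have a1 := Nat.floor_le hs0
  have a2 := Nat.lt_floor_add_one (Real.sqrt l)
  have b1 := Int.floor_le l
  have b2 := Int.lt_floor_add_one l
  have b0 : (0 : ℝ) ≤ ⌊l⌋ := by exact_mod_cast hfl0
  constructor
  · rw [one_mul]
    exact mul_le_mul a2.le (by linarith) hl0.le (by positivity)
  · calc ((⌊Real.sqrt l⌋₊ : ℝ) + 1) * (2 * (⌊l⌋ : ℝ) + 1)
        ≤ (2 * Real.sqrt l) * (3 * l) :=
          mul_le_mul (by linarith) (by linarith) (by positivity) (by positivity)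
      _ = 6 * (Real.sqrt l * l) := by ring

lemma massDimR_tube (s : ℝ) (hs : s ∈ Set.Ioo (1 / 2 : ℝ) 1) :
    massDimR (range sqPt ∩ tubeSlope s) = 1 / 2 := by
  obtain ⟨hsa, hsb⟩ := hs
  refine massDimR_eq_of_bounds _ _ (1 / 2) 4 (by norm_num) (by norm_num) ?_
  intro l hl
  have hl0 : 0 < l := by linarith
  have hq : Real.sqrt l ^ 2 = l := Real.sq_sqrt hl0.le
  have hq0 : 0 ≤ Real.sqrt l := Real.sqrt_nonneg l
  have hq1 : 1 ≤ Real.sqrt l := Real.one_le_sqrt.2 (by linarith)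
  have hw1 : 1 ≤ Real.sqrt (1 + s ^ 2) := Real.one_le_sqrt.2 (by nlinarith)
  have hw2 : Real.sqrt (1 + s ^ 2) ≤ 2 := Real.sqrt_le_iff.2 ⟨by norm_num, by nlinarith⟩
  rw [← Real.sqrt_eq_rpow]
  have hsub : range sqPt ∩ tubeSlope s ∩ (Set.Icc (-l) l ×ˢ Set.Icc (-l) l) ⊆
      (fun p : ℕ × ℤ => sqPt (p.1, ⌊s * (p.1 : ℝ) ^ 2⌋ + p.2)) ''
      (((Finset.range (⌊Real.sqrt l⌋₊ + 1)) ×ˢ (Finset.Icc (1 : ℤ) 2) :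
        Finset (ℕ × ℤ)) : Set (ℕ × ℤ)) := by
    rintro _ ⟨⟨⟨⟨k, j⟩, rfl⟩, ht1, ht2⟩, ⟨⟨_, h1⟩, _⟩⟩
    simp only [sqPt] at h1 ht1 ht2
    refine ⟨(k, j - ⌊s * (k : ℝ) ^ 2⌋), ?_, by simp⟩
    simp only [Finset.coe_product, Set.mem_prod, Finset.mem_coe, Finset.mem_range,
      Finset.mem_Icc]
    have h2 : ⌊s * (k : ℝ) ^ 2⌋ < j := Int.floor_lt.2 ht1
    have h3 : j - 2 ≤ ⌊s * (k : ℝ) ^ 2⌋ := Int.le_floor.2 (by push_cast; linarith)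
    exact ⟨nat_le_floor_sqrt h1, by omega, by omega⟩
  have hfin : (range sqPt ∩ tubeSlope s ∩ (Set.Icc (-l) l ×ˢ Set.Icc (-l) l)).Finite :=
    ((Finset.finite_toSet _).image _).subset hsub
  constructor
  · have hsub2 : (fun k : ℕ => sqPt (k, ⌊s * (k : ℝ) ^ 2⌋ + 1)) ''
        (Finset.range (⌊Real.sqrt l / 2⌋₊ + 1) : Set ℕ) ⊆
        range sqPt ∩ tubeSlope s ∩ (Set.Icc (-l) l ×ˢ Set.Icc (-l) l) := by
      rintro _ ⟨k, hk, rfl⟩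
      rw [Finset.mem_coe, Finset.mem_range] at hk
      have hk1 : (k : ℝ) ≤ Real.sqrt l / 2 :=
        (Nat.le_floor_iff (by positivity)).1 (Nat.le_of_lt_succ hk)
      have hk0 : (0 : ℝ) ≤ k := Nat.cast_nonneg k
      have hk2 : (k : ℝ) ^ 2 ≤ l / 4 := by nlinarith
      have hk3 : (0 : ℝ) ≤ (k : ℝ) ^ 2 := by positivity
      have hsk : s * (k : ℝ) ^ 2 ≤ (k : ℝ) ^ 2 := by nlinarith
      have hsk0 : 0 ≤ s * (k : ℝ) ^ 2 := by positivity
      have f1 := Int.floor_le (s * (k : ℝ) ^ 2)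
      have f2 := Int.lt_floor_add_one (s * (k : ℝ) ^ 2)
      refine ⟨⟨⟨_, rfl⟩, ?_, ?_⟩, ⟨?_, ?_⟩, ⟨?_, ?_⟩⟩ <;> simp only [sqPt] <;> push_cast <;>
        linarith
    have hinj : Function.Injective (fun k : ℕ => sqPt (k, ⌊s * (k : ℝ) ^ 2⌋ + 1)) := by
      intro k k' h
      exact congrArg Prod.fst (sqPt_injective h)
    have h1 := Set.ncard_le_ncard hsub2 hfin
    rw [Set.ncard_image_of_injective _ hinj, Set.ncard_coe_finset, Finset.card_range] at h1
    have h2 : ((⌊Real.sqrt l / 2⌋₊ + 1 : ℕ) : ℝ) ≤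
      ((range sqPt ∩ tubeSlope s ∩ (Set.Icc (-l) l ×ˢ Set.Icc (-l) l)).ncard : ℝ) := by
      exact_mod_cast h1
    have h3 := Nat.lt_floor_add_one (Real.sqrt l / 2)
    push_cast at h2
    linarith
  · have h1 := (Set.ncard_le_ncard hsub ((Finset.finite_toSet _).image _)).trans
      (Set.ncard_image_le (Finset.finite_toSet _))
    rw [Set.ncard_coe_finset, Finset.card_product, Finset.card_range, Int.card_Icc] at h1
    have h2 : ((range sqPt ∩ tubeSlope s ∩ (Set.Icc (-l) l ×ˢ Set.Icc (-l) l)).ncard : ℝ) ≤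
      ((⌊Real.sqrt l⌋₊ : ℝ) + 1) * 2 := by
      exact_mod_cast h1
    have a1 := Nat.floor_le hq0
    linarith

/-- There exists a 1-separated set `E ⊆ ℝ²` with `D̄(E) = 3/2` and a nonempty
open interval `I ⊆ (0,∞)` such that for every `s ∈ I`,
`D̄(E ∩ T_s) = 1/2`.  Hence the bound `D̄(E ∩ t) ≤ max(0, D̄(E) − 1)` of the
slicing theorem is attained and cannot be improved. -/
theorem exists_dim_three_halves_slices_dim_half :
    ∃ E : Set (ℝ × ℝ), OneSeparated E ∧ massDimR E = 3 / 2 ∧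
      ∃ a b : ℝ, 0 < a ∧ a < b ∧
        ∀ s ∈ Set.Ioo a b, massDimR (E ∩ tubeSlope s) = 1 / 2 := by
  exact ⟨range sqPt, sqPt_separated, massDimR_range_sqPt, 1 / 2, 1, by norm_num, by norm_num,
    massDimR_tube⟩
end

section
/- For every η with 0 < η < 1, there exists a 1-separated set E ⊆ ℝ² with mass dimension D̄(E) = 1 + η and a nonempty open interval I ⊆ (0,∞) such that for every slope s ∈ I, the intersection E ∩ T_s has mass dimension D̄(E ∩ T_s) = η, where T_s is the width-1 tube of slope s whose lower boundary line passes through the origin. -/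
open Filter Set

/-- Power-law counting bounds determine the limsup. -/
lemma limsup_log_of_bounds (N : ℝ → ℝ) (d c C : ℝ) (hc : 0 < c)
    (hlow : ∀ᶠ l in atTop, c * l ^ d ≤ N l) (hup : ∀ᶠ l in atTop, N l ≤ C * l ^ d) :
    Filter.limsup (fun l : ℝ => Real.log (N l) / Real.log (2 * l)) atTop = d := by
  apply Tendsto.limsup_eq
  have hC : 0 < C := by
    obtain ⟨l, h1, h2, h3⟩ := (hlow.and (hup.and (eventually_gt_atTop (0:ℝ)))).exists
    have := Real.rpow_pos_of_pos h3 d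
    by_contra hh
    nlinarith [mul_pos hc this]
  have hlog : Tendsto (fun l : ℝ => Real.log (2 * l)) atTop atTop :=
    Real.tendsto_log_atTop.comp (tendsto_id.const_mul_atTop (by norm_num : (0:ℝ) < 2))
  have key : ∀ k : ℝ, Tendsto (fun l : ℝ => d + (k - d * Real.log 2) / Real.log (2 * l))
      atTop (nhds d) := by
    intro k
    simpa using (tendsto_const_nhds (x := d)).add (hlog.const_div_atTop (k - d * Real.log 2))
  have expand : ∀ k : ℝ, 0 < k → ∀ l : ℝ, 1 < l →
      Real.log (k * l ^ d) / Real.log (2 * l)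
        = d + (Real.log k - d * Real.log 2) / Real.log (2 * l) := by
    intro k hk l hl
    have hl0 : 0 < l := by linarith
    have h2 : 0 < Real.log (2 * l) := Real.log_pos (by linarith)
    rw [Real.log_mul hk.ne' (Real.rpow_pos_of_pos hl0 d).ne', Real.log_rpow hl0]
    have h3 : Real.log (2 * l) = Real.log 2 + Real.log l :=
      Real.log_mul (by norm_num) hl0.ne'
    field_simp
    rw [h3]; ring
  refine tendsto_of_tendsto_of_tendsto_of_le_of_le' (key (Real.log c)) (key (Real.log C)) ?_ ?_
  · filter_upwards [hlow, eventually_gt_atTop (1:ℝ)] with l h1 h2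
    rw [← expand c hc l h2]
    have h3 : 0 < Real.log (2 * l) := Real.log_pos (by linarith)
    have h4 : 0 < c * l ^ d := mul_pos hc (Real.rpow_pos_of_pos (by linarith) d)
    exact div_le_div_of_nonneg_right (Real.log_le_log h4 h1) h3.le
  · filter_upwards [hlow, hup, eventually_gt_atTop (1:ℝ)] with l h0 h1 h2
    rw [← expand C hC l h2]
    have h3 : 0 < Real.log (2 * l) := Real.log_pos (by linarith)
    have h4 : 0 < c * l ^ d := mul_pos hc (Real.rpow_pos_of_pos (by linarith) d)
    exact div_le_div_of_nonneg_right (Real.log_le_log (h4.trans_le h0) h1) h3.le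

/-- The sparse sequence of abscissae. -/
noncomputable def absc (η : ℝ) (n : ℕ) : ℕ := ⌊(n : ℝ) ^ (1 / η)⌋₊

lemma absc_strictMono (η : ℝ) (h0 : 0 < η) (h1 : η < 1) : StrictMono (absc η) := by
  apply strictMono_nat_of_lt_succ
  intro n
  have hp : 1 ≤ 1 / η := by rw [le_div_iff₀ h0]; linarith
  have h := Real.add_rpow_le_rpow_add (a := (n:ℝ)) (b := 1) (by positivity) (by norm_num) hp
  rw [Real.one_rpow] at h
  unfold absc
  have h2 : ⌊(n : ℝ) ^ (1 / η)⌋₊ + 1 ≤ ⌊((n + 1 : ℕ) : ℝ) ^ (1 / η)⌋₊ := by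
    apply Nat.le_floor
    push_cast
    have := Nat.floor_le (a := (n : ℝ) ^ (1 / η)) (by positivity)
    linarith
  omega

lemma absc_le (η : ℝ) (h0 : 0 < η) (n : ℕ) (l : ℝ) (hl : 0 ≤ l) (h : (n : ℝ) ≤ l ^ η) :
    (absc η n : ℝ) ≤ l := by
  have h1 : (absc η n : ℝ) ≤ (n : ℝ) ^ (1 / η) := Nat.floor_le (by positivity)
  have h2 : (n : ℝ) ^ (1 / η) ≤ (l ^ η) ^ (1 / η) :=
    Real.rpow_le_rpow (by positivity) h (by positivity)
  rw [← Real.rpow_mul hl, mul_one_div_cancel h0.ne', Real.rpow_one] at h2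
  linarith

lemma le_of_absc_le (η : ℝ) (h0 : 0 < η) (n : ℕ) (l : ℝ) (hl : 0 ≤ l)
    (h : (absc η n : ℝ) ≤ l) : (n : ℝ) ≤ (l + 1) ^ η := by
  have h1 : (n : ℝ) ^ (1 / η) < (absc η n : ℝ) + 1 := Nat.lt_floor_add_one _
  have h2 : ((n : ℝ) ^ (1 / η)) ^ η ≤ (l + 1) ^ η :=
    Real.rpow_le_rpow (by positivity) (by linarith) h0.le
  rwa [← Real.rpow_mul (by positivity), one_div_mul_cancel h0.ne', Real.rpow_one] at h2

/-- The point with column index `n` and integer height `m`. -/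
noncomputable def gpt (η : ℝ) (p : ℕ × ℤ) : ℝ × ℝ := ((absc η p.1 : ℝ), (p.2 : ℝ))

lemma gpt_inj (η : ℝ) (h0 : 0 < η) (h1 : η < 1) : Function.Injective (gpt η) := by
  rintro ⟨n, m⟩ ⟨n', m'⟩ h
  simp only [gpt, Prod.mk.injEq, Nat.cast_inj, Int.cast_inj] at h
  rw [(absc_strictMono η h0 h1).injective h.1, h.2]

/-- Number of relevant columns. -/
noncomputable def ncol (η l : ℝ) : ℕ := ⌈(l + 1) ^ η⌉₊ + 1

lemma ncol_le (η l : ℝ) (h0 : 0 < η) (h1 : η < 1) (hl : 1 ≤ l) : (ncol η l : ℝ) ≤ 4 * l ^ η := by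
  have a1 : (l + 1) ^ η ≤ (2 * l) ^ η :=
    Real.rpow_le_rpow (by linarith) (by linarith) h0.le
  rw [Real.mul_rpow (by norm_num) (by linarith)] at a1
  have a2 : (2:ℝ) ^ η ≤ 2 := by
    simpa using Real.rpow_le_rpow_of_exponent_le (x := 2) (by norm_num) h1.le
  have a3 : 1 ≤ l ^ η := Real.one_le_rpow hl h0.le
  have a4 : (⌈(l + 1) ^ η⌉₊ : ℝ) < (l + 1) ^ η + 1 := Nat.ceil_lt_add_one (by positivity)
  unfold ncol
  push_cast
  nlinarith

lemma mem_ncol (η l : ℝ) (h0 : 0 < η) (hl : 1 ≤ l) (n : ℕ) (h : (absc η n : ℝ) ≤ l) :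
    n < ncol η l := by
  have a := le_of_absc_le η h0 n l (by linarith) h
  have b : n ≤ ⌈(l + 1) ^ η⌉₊ := by exact_mod_cast a.trans (Nat.le_ceil _)
  unfold ncol; omega

lemma box_upper_sub (η l : ℝ) (h0 : 0 < η) (hl : 1 ≤ l) :
    range (gpt η) ∩ (Icc (-l) l ×ˢ Icc (-l) l) ⊆
      (gpt η) '' ((Finset.range (ncol η l) ×ˢ Finset.Icc (-(⌈l⌉)) ⌈l⌉ : Finset (ℕ × ℤ)) :
        Set (ℕ × ℤ)) := by
  rintro _ ⟨⟨⟨n, m⟩, rfl⟩, ⟨_, hx⟩, hy1, hy2⟩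
  refine ⟨(n, m), ?_, rfl⟩
  simp only [gpt] at hx hy1 hy2
  simp only [Finset.coe_product, Set.mem_prod, Finset.mem_coe, Finset.mem_range, Finset.mem_Icc]
  refine ⟨mem_ncol η l h0 hl n hx, ?_, ?_⟩
  · have : (-(⌈l⌉ : ℤ) : ℝ) ≤ m := by have := Int.le_ceil l; linarith
    exact_mod_cast this
  · have : (m : ℝ) ≤ (⌈l⌉ : ℤ) := by have := Int.le_ceil l; linarith
    exact_mod_cast this

lemma box_finite_s18 (η l : ℝ) (h0 : 0 < η) (hl : 1 ≤ l) :
    (range (gpt η) ∩ (Icc (-l) l ×ˢ Icc (-l) l)).Finite :=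
  ((Finset.finite_toSet _).image _).subset (box_upper_sub η l h0 hl)

lemma box_upper (η l : ℝ) (h0 : 0 < η) (h1 : η < 1) (hl : 1 ≤ l) :
    ((range (gpt η) ∩ (Icc (-l) l ×ˢ Icc (-l) l)).ncard : ℝ) ≤ 20 * l ^ (1 + η) := by
  have a := Set.ncard_le_ncard (box_upper_sub η l h0 hl) ((Finset.finite_toSet _).image _)
  rw [Set.ncard_image_of_injective _ (gpt_inj η h0 h1), Set.ncard_coe_finset,
    Finset.card_product, Finset.card_range, Int.card_Icc] at a
  have hcpos : 0 ≤ ⌈l⌉ := Int.ceil_nonneg (by linarith)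
  have b : (((⌈l⌉ + 1 - -⌈l⌉).toNat : ℕ) : ℝ) ≤ 5 * l := by
    have e : (((⌈l⌉ + 1 - -⌈l⌉).toNat : ℕ) : ℤ) = 2 * ⌈l⌉ + 1 := by omega
    have e' : (((⌈l⌉ + 1 - -⌈l⌉).toNat : ℕ) : ℝ) = 2 * (⌈l⌉ : ℝ) + 1 := by exact_mod_cast e
    rw [e']
    have := Int.ceil_lt_add_one l
    linarith
  have c := ncol_le η l h0 h1 hl
  have a' : ((range (gpt η) ∩ (Icc (-l) l ×ˢ Icc (-l) l)).ncard : ℝ) ≤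
      (ncol η l : ℝ) * ((⌈l⌉ + 1 - -⌈l⌉).toNat : ℕ) := by exact_mod_cast a
  have l0 : 0 < l := by linarith
  calc _ ≤ _ := a'
    _ ≤ (4 * l ^ η) * (5 * l) := by gcongr
    _ = 20 * l ^ (1 + η) := by rw [Real.rpow_add l0, Real.rpow_one]; ring

lemma box_lower (η l : ℝ) (h0 : 0 < η) (h1 : η < 1) (hl : 1 ≤ l) :
    1 * l ^ (1 + η) ≤ ((range (gpt η) ∩ (Icc (-l) l ×ˢ Icc (-l) l)).ncard : ℝ) := by
  have l0 : 0 < l := by linarith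
  have sub : (gpt η) '' ((Finset.range (⌊l ^ η⌋₊ + 1) ×ˢ Finset.Icc 0 ⌊l⌋ : Finset (ℕ × ℤ)) :
        Set (ℕ × ℤ)) ⊆ range (gpt η) ∩ (Icc (-l) l ×ˢ Icc (-l) l) := by
    rintro _ ⟨⟨n, m⟩, h, rfl⟩
    simp only [Finset.coe_product, Set.mem_prod, Finset.mem_coe, Finset.mem_range,
      Finset.mem_Icc] at h
    obtain ⟨hn, hm0, hm⟩ := h
    have hn' : (n : ℝ) ≤ l ^ η := (Nat.le_floor_iff (by positivity)).1 (by omega)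
    have hx := absc_le η h0 n l l0.le hn'
    have hx0 : (0:ℝ) ≤ absc η n := by positivity
    have hm' : (m : ℝ) ≤ l := Int.le_floor.1 hm
    have hm0' : (0:ℝ) ≤ m := by exact_mod_cast hm0
    refine ⟨⟨_, rfl⟩, ⟨?_, ?_⟩, ?_, ?_⟩ <;> simp only [gpt] <;> linarith
  have a := Set.ncard_le_ncard sub (box_finite_s18 η l h0 hl)
  rw [Set.ncard_image_of_injective _ (gpt_inj η h0 h1), Set.ncard_coe_finset,
    Finset.card_product, Finset.card_range, Int.card_Icc] at a
  have hf : 0 ≤ ⌊l⌋ := Int.floor_nonneg.2 l0.le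
  have b : l ≤ (((⌊l⌋ + 1 - 0).toNat : ℕ) : ℝ) := by
    have e : (((⌊l⌋ + 1 - 0).toNat : ℕ) : ℤ) = ⌊l⌋ + 1 := by omega
    have e' : (((⌊l⌋ + 1 - 0).toNat : ℕ) : ℝ) = (⌊l⌋ : ℝ) + 1 := by exact_mod_cast e
    rw [e']
    exact (Int.lt_floor_add_one l).le
  have c : l ^ η ≤ ((⌊l ^ η⌋₊ + 1 : ℕ) : ℝ) := by
    push_cast; exact (Nat.lt_floor_add_one _).le
  calc 1 * l ^ (1 + η) = l ^ η * l := by rw [Real.rpow_add l0, Real.rpow_one]; ring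
    _ ≤ ((⌊l ^ η⌋₊ + 1 : ℕ) : ℝ) * (((⌊l⌋ + 1 - 0).toNat : ℕ) : ℝ) := by gcongr
    _ ≤ _ := by exact_mod_cast a

lemma sqrt_bounds (s : ℝ) (hs : s ∈ Ioo (1/2 : ℝ) 1) :
    1 ≤ Real.sqrt (1 + s ^ 2) ∧ Real.sqrt (1 + s ^ 2) < 2 := by
  obtain ⟨h1, h2⟩ := hs
  constructor
  · rw [Real.one_le_sqrt]; nlinarith
  · rw [Real.sqrt_lt' (by norm_num)]; nlinarith

lemma tube_upper (η l s : ℝ) (h0 : 0 < η) (h1 : η < 1) (hl : 1 ≤ l)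
    (hs : s ∈ Ioo (1/2 : ℝ) 1) :
    (((range (gpt η) ∩ tubeSlope s) ∩ (Icc (-l) l ×ˢ Icc (-l) l)).ncard : ℝ)
      ≤ 8 * l ^ η := by
  classical
  have sub : (range (gpt η) ∩ tubeSlope s) ∩ (Icc (-l) l ×ˢ Icc (-l) l) ⊆
      (fun p : ℕ × ℤ => gpt η (p.1, ⌊s * absc η p.1⌋ + p.2)) ''
        ((Finset.range (ncol η l) ×ˢ Finset.Icc 1 2 : Finset (ℕ × ℤ)) : Set (ℕ × ℤ)) := by
    rintro _ ⟨⟨⟨⟨n, m⟩, rfl⟩, ht1, ht2⟩, ⟨_, hx⟩, _⟩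
    simp only [gpt] at hx ht1 ht2
    have hq := (sqrt_bounds s hs).2
    refine ⟨(n, m - ⌊s * absc η n⌋), ?_, by simp⟩
    simp only [Finset.coe_product, Set.mem_prod, Finset.mem_coe, Finset.mem_range,
      Finset.mem_Icc]
    have e1 : ⌊s * (absc η n : ℝ)⌋ < m := Int.floor_lt.2 ht1
    have e2 : (m : ℝ) < ((⌊s * (absc η n : ℝ)⌋ + 3 : ℤ) : ℝ) := by
      push_cast
      have := Int.lt_floor_add_one (s * (absc η n : ℝ))
      linarith
    have e3 : m < ⌊s * (absc η n : ℝ)⌋ + 3 := by exact_mod_cast e2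
    exact ⟨mem_ncol η l h0 hl n hx, by omega, by omega⟩
  have a := Set.ncard_le_ncard sub ((Finset.finite_toSet _).image _)
  have a2 := a.trans (Set.ncard_image_le (Finset.finite_toSet _))
  rw [Set.ncard_coe_finset, Finset.card_product, Finset.card_range, Int.card_Icc] at a2
  have c := ncol_le η l h0 h1 hl
  have a3 : (((range (gpt η) ∩ tubeSlope s) ∩ (Icc (-l) l ×ˢ Icc (-l) l)).ncard : ℝ) ≤
      (ncol η l : ℝ) * 2 := by exact_mod_cast a2
  linarith

lemma tube_lower (η l s : ℝ) (h0 : 0 < η) (h1 : η < 1) (hl : 4 ≤ l)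
    (hs : s ∈ Ioo (1/2 : ℝ) 1) :
    (1 / 2) ^ η * l ^ η ≤
      (((range (gpt η) ∩ tubeSlope s) ∩ (Icc (-l) l ×ˢ Icc (-l) l)).ncard : ℝ) := by
  have l0 : 0 < l := by linarith
  have sub : (fun n : ℕ => gpt η (n, ⌊s * absc η n⌋ + 1)) ''
      ((Finset.range (⌊(1 / 2 * l) ^ η⌋₊ + 1) : Finset ℕ) : Set ℕ) ⊆
        (range (gpt η) ∩ tubeSlope s) ∩ (Icc (-l) l ×ˢ Icc (-l) l) := by
    rintro _ ⟨n, hn, rfl⟩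
    simp only [Finset.mem_coe, Finset.mem_range] at hn
    have hn' : (n : ℝ) ≤ (1 / 2 * l) ^ η := (Nat.le_floor_iff (by positivity)).1 (by omega)
    have hx := absc_le η h0 n _ (by positivity) hn'
    have hx0 : (0:ℝ) ≤ absc η n := by positivity
    have hq := (sqrt_bounds s hs).1
    have f1 := Int.lt_floor_add_one (s * (absc η n : ℝ))
    have f2 := Int.floor_le (s * (absc η n : ℝ))
    obtain ⟨hs1, hs2⟩ := hs
    have f3 : s * (absc η n : ℝ) ≤ absc η n := by nlinarith
    have f4 : 0 ≤ s * (absc η n : ℝ) := by positivity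
    refine ⟨⟨⟨_, rfl⟩, ?_, ?_⟩, ⟨?_, ?_⟩, ?_, ?_⟩ <;> simp only [gpt] <;> push_cast <;> linarith
  have fin : ((range (gpt η) ∩ tubeSlope s) ∩ (Icc (-l) l ×ˢ Icc (-l) l)).Finite :=
    (box_finite_s18 η l h0 (by linarith)).subset (fun q hq => ⟨hq.1.1, hq.2⟩)
  have a := Set.ncard_le_ncard sub fin
  have inj : Function.Injective (fun n : ℕ => gpt η (n, ⌊s * absc η n⌋ + 1)) := by
    intro n n' h
    exact congrArg Prod.fst (gpt_inj η h0 h1 h)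
  rw [Set.ncard_image_of_injective _ inj, Set.ncard_coe_finset, Finset.card_range] at a
  rw [← Real.mul_rpow (by norm_num) l0.le]
  have c : (1 / 2 * l) ^ η ≤ ((⌊(1 / 2 * l) ^ η⌋₊ + 1 : ℕ) : ℝ) := by
    push_cast; exact (Nat.lt_floor_add_one _).le
  exact c.trans (by exact_mod_cast a)

lemma range_sep (η : ℝ) : OneSeparated (range (gpt η)) := by
  rintro _ ⟨⟨n, m⟩, rfl⟩ _ ⟨⟨n', m'⟩, rfl⟩ hne
  rw [Real.one_le_sqrt]
  simp only [gpt] at hne ⊢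
  have key : (1:ℤ) ≤ ((absc η n : ℤ) - absc η n') ^ 2 + (m - m') ^ 2 := by
    by_contra hcon
    have e1 : ((absc η n : ℤ) - absc η n') ^ 2 = 0 := by
      nlinarith [sq_nonneg ((absc η n : ℤ) - absc η n'), sq_nonneg (m - m')]
    have e2 : (m - m') ^ 2 = 0 := by
      nlinarith [sq_nonneg ((absc η n : ℤ) - absc η n'), sq_nonneg (m - m')]
    have e3 : (absc η n : ℤ) = absc η n' := sub_eq_zero.1 (pow_eq_zero_iff (by norm_num) |>.1 e1)
    have e4 : m = m' := sub_eq_zero.1 (pow_eq_zero_iff (by norm_num) |>.1 e2)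
    have e5 : absc η n = absc η n' := by exact_mod_cast e3
    exact hne (by rw [e4, e5])
  exact_mod_cast key

/-- For every `0 < η < 1` there exists a 1-separated set `E ⊆ ℝ²` with
`D̄(E) = 1 + η` and a nonempty open interval `I ⊆ (0,∞)` such that for every
`s ∈ I`, `D̄(E ∩ T_s) = η`. -/
theorem exists_dim_one_add_eta_slices_dim_eta (η : ℝ) (hη0 : 0 < η) (hη1 : η < 1) :
    ∃ E : Set (ℝ × ℝ), OneSeparated E ∧ massDimR E = 1 + η ∧
      ∃ a b : ℝ, 0 < a ∧ a < b ∧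
        ∀ s ∈ Set.Ioo a b, massDimR (E ∩ tubeSlope s) = η := by
  refine ⟨range (gpt η), range_sep η, ?_, 1 / 2, 1, by norm_num, by norm_num, ?_⟩
  · refine limsup_log_of_bounds _ (1 + η) 1 20 one_pos ?_ ?_
    · filter_upwards [eventually_ge_atTop (1:ℝ)] with l hl using box_lower η l hη0 hη1 hl
    · filter_upwards [eventually_ge_atTop (1:ℝ)] with l hl using box_upper η l hη0 hη1 hl
  · intro s hs
    refine limsup_log_of_bounds _ η ((1 / 2) ^ η) 8 (by positivity) ?_ ?_
    · filter_upwards [eventually_ge_atTop (4:ℝ)] with l hl using tube_lower η l s hη0 hη1 hl hs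
    · filter_upwards [eventually_ge_atTop (1:ℝ)] with l hl using tube_upper η l s hη0 hη1 hl hs
end
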